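/- arXiv:math/0211324 — 4 statements merged into one kernel-verified Lean document; each statement's English description precedes it below -/
import Mathlib

section
/- Assume f is an open, π-regular polynomial map with α_m > 1, let G_i := lim_n G_{i,n} (defined and finite on K_{i−1}, with G_i∘f = α_i·G_i and G_i = 0 on K), and let K := K_m be the compact set of points with bounded orbit, which satisfies f(K) ⊆ K. Let W be a bounded open neighborhood of K, N ≥ 1 an integer and L > 1 a real number such that |f^N(u) − f^N(v)| ≤ L^N·|u − v| for all u, v ∈ W. Then for every 1 ≤ i ≤ m and every 0 < a < log α_i / log L there exists c > 0 such that G_i(z) ≤ c·dist(z, K)^a for all z ∈ K_{i−1}. -/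
open MvPolynomial Filter Topology Metric Set

noncomputable section

def logPlus (x : ℝ) : ℝ := max (Real.log x) 0

/-- Weighted degree of a monomial: the variable `t` (lying in block `B t`) has
weight `p (B t)`. -/
def wdeg (k : ℕ) (p : ℕ → ℕ) (B : Fin k → ℕ) (s : Fin k →₀ ℕ) : ℕ :=
  ∑ t : Fin k, p (B t) * s t

/-- `P̌_j`: the sum of the monomials of `P j` (with their coefficients) of maximal
weighted degree `dπ_{B j}`. -/
def checkP (k : ℕ) (P : Fin k → MvPolynomial (Fin k) ℂ) (p : ℕ → ℕ)
    (B : Fin k → ℕ) (dpi : ℕ → ℕ) (j : Fin k) : MvPolynomial (Fin k) ℂ :=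
  ∑ s ∈ (P j).support.filter (fun s => wdeg k p B s = dpi (B j)),
    monomial s (coeff s (P j))

/-- `P̌⁺_j`: the homogeneous part of degree `α_i = dπ_i/p_i` of `P̌_j`
(the zero polynomial if `α_i` is not an integer). -/
def checkPplus (k : ℕ) (P : Fin k → MvPolynomial (Fin k) ℂ) (p : ℕ → ℕ)
    (B : Fin k → ℕ) (dpi : ℕ → ℕ) (j : Fin k) : MvPolynomial (Fin k) ℂ :=
  if p (B j) ∣ dpi (B j) then
    homogeneousComponent (dpi (B j) / p (B j)) (checkP k P p B dpi j)
  else 0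

/-- The affine cone `C(I_i)` over the indeterminacy set `I_i`:
`C(I_0) = ℂ^k` and `C(I_i) = C(I_{i−1}) ∩ {P̌⁺_{(i)} = 0} ∩ {z_{(j)} = 0 for p_j < p_i}`. -/
def coneI (k : ℕ) (P : Fin k → MvPolynomial (Fin k) ℂ) (p : ℕ → ℕ)
    (B : Fin k → ℕ) (dpi : ℕ → ℕ) (l : ℕ → ℕ) : ℕ → Set (Fin k → ℂ)
  | 0 => Set.univ
  | (i + 1) =>
      coneI k P p B dpi l i ∩
      {z | ∀ j : Fin k, l i ≤ (j : ℕ) → (j : ℕ) < l (i + 1) →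
        eval z (checkPplus k P p B dpi j) = 0} ∩
      {z | ∀ j : Fin k, p (B j) < p (i + 1) → z j = 0}

/-- The affine cone `C(X_i) = C(I_{i−1}) ∩ {z_{(>i)} = 0}` over the attracting set
`X_i`. -/
def coneX (k : ℕ) (P : Fin k → MvPolynomial (Fin k) ℂ) (p : ℕ → ℕ)
    (B : Fin k → ℕ) (dpi : ℕ → ℕ) (l : ℕ → ℕ) (i : ℕ) : Set (Fin k → ℂ) :=
  coneI k P p B dpi l (i - 1) ∩ {z | ∀ j : Fin k, l i ≤ (j : ℕ) → z j = 0}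

/-- `α_i := dπ_i / p_i`. -/
def alphaR (p dpi : ℕ → ℕ) (i : ℕ) : ℝ := (dpi i : ℝ) / (p i : ℝ)

/-- `Σ^π_i`: the unit-sphere slice of the cone `C(X_i)`. -/
def sigmaPi (k : ℕ) (P : Fin k → MvPolynomial (Fin k) ℂ) (p : ℕ → ℕ)
    (B : Fin k → ℕ) (dpi : ℕ → ℕ) (l : ℕ → ℕ) (i : ℕ) :
    Set (EuclideanSpace ℂ (Fin k)) :=
  {w | ‖w‖ = 1 ∧ (fun t => w t) ∈ coneX k P p B dpi l i}

/-- `U_i`: basin of the attracting set `X_i` at infinity. -/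
def basinPi (k : ℕ) (f : EuclideanSpace ℂ (Fin k) → EuclideanSpace ℂ (Fin k))
    (P : Fin k → MvPolynomial (Fin k) ℂ) (p : ℕ → ℕ)
    (B : Fin k → ℕ) (dpi : ℕ → ℕ) (l : ℕ → ℕ) (i : ℕ) :
    Set (EuclideanSpace ℂ (Fin k)) :=
  {z | Tendsto (fun n => ‖f^[n] z‖) atTop atTop ∧
    Tendsto (fun n => infDist (‖f^[n] z‖⁻¹ • f^[n] z) (sigmaPi k P p B dpi l i))
      atTop (𝓝 0)}

/-- `K_i = K_{i−1} \ U_i` (with `K_0 = ℂ^k`), unfolded. -/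
def kSetPi (k : ℕ) (f : EuclideanSpace ℂ (Fin k) → EuclideanSpace ℂ (Fin k))
    (P : Fin k → MvPolynomial (Fin k) ℂ) (p : ℕ → ℕ)
    (B : Fin k → ℕ) (dpi : ℕ → ℕ) (l : ℕ → ℕ) (i : ℕ) :
    Set (EuclideanSpace ℂ (Fin k)) :=
  {z | ∀ j : ℕ, 1 ≤ j → j ≤ i → z ∉ basinPi k f P p B dpi l j}

end

attribute [local instance] MvPolynomial.gradedAlgebra in
theorem homogeneousComponent_mul_of_isHomogeneous {σ : Type*} {e n : ℕ} (a b : MvPolynomial σ ℂ)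
    (hb : b.IsHomogeneous e) :
    homogeneousComponent n (a * b) =
      if e ≤ n then homogeneousComponent (n - e) a * b else 0 := by
  have h := DirectSum.coe_decompose_mul_of_right_mem (homogeneousSubmodule σ ℂ) (a := a) n
    ((mem_homogeneousSubmodule e b).2 hb)
  have h1 := decomposition.decompose'_apply (a * b) n
  have h2 := decomposition.decompose'_apply a (n - e)
  rw [← h1, ← h2]
  exact h

theorem totalDegree_sub_homogeneousComponent_lt {σ : Type*} {e : ℕ} (he : 1 ≤ e)
    (q : MvPolynomial σ ℂ) (hq : q.totalDegree ≤ e) :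
    (q - homogeneousComponent e q).totalDegree < e := by
  rw [totalDegree, Finset.sup_lt_iff (by simp; omega)]
  intro s hs
  by_contra hcon
  push Not at hcon
  rw [mem_support_iff, coeff_sub, coeff_homogeneousComponent] at hs
  split_ifs at hs with h
  · simp at hs
  · have h1 : s ∈ q.support := by simpa using hs
    have h2 := le_totalDegree h1
    have h3 : s.degree = s.sum fun _ e => e := rfl
    omega

/-- If the top homogeneous parts of `q` have no common zero besides the origin, every polynomial
is in the module spanned over `ℂ[q]` by the monomials of small degree. -/
theorem finite_adjoin_of_top_nonvanishing {σ : Type*} [Finite σ]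
    (q : σ → MvPolynomial σ ℂ) (e : σ → ℕ) (he : ∀ j, 1 ≤ e j)
    (hq : ∀ j, (q j).totalDegree ≤ e j)
    (hz : ∀ w : σ → ℂ, (∀ j, eval w (homogeneousComponent (e j) (q j)) = 0) → w = 0) :
    Module.Finite (Algebra.adjoin ℂ (range q)) (MvPolynomial σ ℂ) := by
  classical
  have := Fintype.ofFinite σ
  set I : Ideal (MvPolynomial σ ℂ) :=
    Ideal.span (range fun j => homogeneousComponent (e j) (q j)) with hI
  have hle : idealOfVars σ ℂ ≤ I.radical := by
    rw [← vanishingIdeal_zeroLocus_eq_radical (K := ℂ), Ideal.span_le]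
    rintro _ ⟨t, rfl⟩
    intro w hw
    have : w = 0 := hz w fun j => by
      have := hw _ (Ideal.subset_span (mem_range_self j))
      simpa [aeval_eq_eval] using this
    simp [this]
  obtain ⟨D, hD⟩ := Ideal.exists_pow_le_of_le_radical_of_fg hle (idealOfVars_fg σ ℂ)
  have hfin : {s : σ →₀ ℕ | s.degree < D}.Finite := by
    have := Finsupp.finite_of_degree_le (σ := σ) (n := D)
    exact this.subset fun s hs => le_of_lt (show s.degree < D from hs)
  set A := Algebra.adjoin ℂ (range q)
  set M : Submodule A (MvPolynomial σ ℂ) :=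
    Submodule.span A ((fun s => monomial s (1 : ℂ)) '' {s : σ →₀ ℕ | s.degree < D}) with hM
  have hC : ∀ (c : ℂ) (x : MvPolynomial σ ℂ), x ∈ M → C c * x ∈ M := fun c x hx => by
    have := M.smul_mem (algebraMap ℂ A c) hx
    rwa [Algebra.smul_def] at this
  have key : ∀ n : ℕ, ∀ x : MvPolynomial σ ℂ, x.totalDegree < n → x ∈ M := by
    intro n
    induction n with
    | zero => intro x hx; omega
    | succ n ih =>
      intro x hx
      rw [x.as_sum]
      refine Submodule.sum_mem _ fun s hs => ?_
      have hsn : s.degree ≤ n := by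
        have := le_totalDegree hs
        have h3 : s.degree = s.sum fun _ e => e := rfl
        omega
      rw [← mul_one (coeff s x), ← C_mul_monomial]
      apply hC
      by_cases hsD : s.degree < D
      · exact Submodule.subset_span ⟨s, hsD, rfl⟩
      have hmem : monomial s (1 : ℂ) ∈ I :=
        hD ((monomial_mem_pow_idealOfVars_iff D s one_ne_zero).2 (by omega))
      rw [hI, Ideal.mem_span_range_iff_exists_fun] at hmem
      obtain ⟨g, hg⟩ := hmem
      have hhom : homogeneousComponent s.degree (monomial s (1 : ℂ)) = monomial s 1 :=
        homogeneousComponent_eq_self (isHomogeneous_monomial _ rfl)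
      rw [← hhom, ← hg, map_sum]
      refine Submodule.sum_mem _ fun j _ => ?_
      rw [homogeneousComponent_mul_of_isHomogeneous _ _ (homogeneousComponent_isHomogeneous _ _)]
      split_ifs with hle'
      swap
      · exact zero_mem _
      set g' := homogeneousComponent (s.degree - e j) (g j)
      have hg' : g'.totalDegree ≤ s.degree - e j :=
        (homogeneousComponent_isHomogeneous _ _).totalDegree_le
      have hsplit : g' * homogeneousComponent (e j) (q j)
          = q j * g' - g' * (q j - homogeneousComponent (e j) (q j)) := by ring
      rw [hsplit]
      have hej := he j
      refine Submodule.sub_mem _ ?_ (ih _ ?_)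
      · exact M.smul_mem (⟨q j, Algebra.subset_adjoin (mem_range_self j)⟩ : A)
          (ih g' (by omega))
      · have h1 := totalDegree_mul g' (q j - homogeneousComponent (e j) (q j))
        have h2 := totalDegree_sub_homogeneousComponent_lt hej _ (hq j)
        omega
  refine ⟨⟨(hfin.image fun s => monomial s (1 : ℂ)).toFinset, ?_⟩⟩
  rw [Set.Finite.coe_toFinset]
  exact eq_top_iff.2 fun x _ => key _ x (Nat.lt_succ_self _)

/-- A polynomial self-map of `ℂ^σ` whose top homogeneous parts have no common zero besides the
origin is surjective. -/
theorem exists_eval_eq_of_top_nonvanishing {σ : Type*} [Finite σ]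
    (q : σ → MvPolynomial σ ℂ) (e : σ → ℕ) (he : ∀ j, 1 ≤ e j)
    (hq : ∀ j, (q j).totalDegree ≤ e j)
    (hz : ∀ w : σ → ℂ, (∀ j, eval w (homogeneousComponent (e j) (q j)) = 0) → w = 0)
    (z : σ → ℂ) : ∃ w : σ → ℂ, ∀ j, eval w (q j) = z j := by
  classical
  have := finite_adjoin_of_top_nonvanishing q e he hq hz
  have halg : AlgebraicIndependent ℂ q :=
    (Algebra.IsAlgebraic.isTranscendenceBasis_of_lift_le_trdeg_of_finite ℂ q (by simp)).1
  set ε : Algebra.adjoin ℂ (range q) →ₐ[ℂ] ℂ :=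
    (aeval z).comp (halg.aevalEquiv.symm : _ →ₐ[ℂ] MvPolynomial σ ℂ) with hε
  have hεq : ∀ j, ε ⟨q j, Algebra.subset_adjoin (mem_range_self j)⟩ = z j := by
    intro j
    have : halg.aevalEquiv.symm ⟨q j, Algebra.subset_adjoin (mem_range_self j)⟩ = X j := by
      rw [AlgEquiv.symm_apply_eq]
      ext1
      simp
    simp [hε, this]
  have : (RingHom.ker ε).IsMaximal :=
    RingHom.ker_isMaximal_of_surjective _ fun c => ⟨algebraMap ℂ _ c, by simp⟩
  obtain ⟨Q, hQ, hQc⟩ := Ideal.exists_ideal_over_maximal_of_isIntegral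
    (S := MvPolynomial σ ℂ) (RingHom.ker ε) (by
      rw [(RingHom.injective_iff_ker_eq_bot _).1 (FaithfulSMul.algebraMap_injective
        (Algebra.adjoin ℂ (range q)) (MvPolynomial σ ℂ))]
      exact bot_le)
  obtain ⟨w, rfl⟩ := isMaximal_iff_eq_vanishingIdeal_singleton.1 hQ
  refine ⟨w, fun j => ?_⟩
  have hmem : (⟨q j, Algebra.subset_adjoin (mem_range_self j)⟩ - algebraMap ℂ _ (z j) :
      Algebra.adjoin ℂ (range q)) ∈ RingHom.ker ε := by
    rw [RingHom.mem_ker, map_sub, hεq]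
    simp
  rw [← hQc, Ideal.mem_comap, mem_vanishingIdeal_singleton_iff, map_sub, map_sub, sub_eq_zero] at hmem
  simpa [aeval_eq_eval] using hmem

theorem eval_smul_of_isHomogeneous {σ : Type*} {p : MvPolynomial σ ℂ} {n : ℕ}
    (hp : p.IsHomogeneous n) (c : ℂ) (w : σ → ℂ) : eval (c • w) p = c ^ n * eval w p := by
  rw [eval_eq, eval_eq, Finset.mul_sum]
  refine Finset.sum_congr rfl fun s hs => ?_
  rw [hp.degree_eq_sum_deg_support hs]
  simp only [Pi.smul_apply, smul_eq_mul, mul_pow, Finset.prod_mul_distrib, Finset.prod_pow_eq_pow_sum]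
  ring

theorem exists_norm_eval_le {σ : Type*} [Fintype σ] (q : MvPolynomial σ ℂ) (e : ℕ)
    (hq : q.totalDegree ≤ e) :
    ∃ C : ℝ, 0 < C ∧ ∀ w : σ → ℂ, ‖eval w q‖ ≤ C * (1 + ‖w‖) ^ e := by
  have hnn : 0 ≤ ∑ s ∈ q.support, ‖coeff s q‖ := Finset.sum_nonneg fun _ _ => norm_nonneg _
  refine ⟨1 + ∑ s ∈ q.support, ‖coeff s q‖, by linarith, fun w => ?_⟩
  have hw := norm_nonneg w
  calc ‖eval w q‖ ≤ ∑ s ∈ q.support, ‖coeff s q‖ * (1 + ‖w‖) ^ e := by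
        rw [eval_eq]
        refine norm_sum_le_of_le _ fun s hs => ?_
        rw [norm_mul, norm_prod]
        refine mul_le_mul_of_nonneg_left ?_ (norm_nonneg _)
        calc ∏ i ∈ s.support, ‖w i ^ s i‖ ≤ ∏ i ∈ s.support, (1 + ‖w‖) ^ s i := by
              refine Finset.prod_le_prod (fun _ _ => norm_nonneg _) fun i _ => ?_
              rw [norm_pow]
              exact pow_le_pow_left₀ (norm_nonneg _) ((norm_le_pi_norm w i).trans (by linarith)) _
          _ = (1 + ‖w‖) ^ (s.sum fun _ e => e) := by rw [Finset.prod_pow_eq_pow_sum]; rfl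
          _ ≤ (1 + ‖w‖) ^ e :=
              pow_le_pow_right₀ (by linarith) ((le_totalDegree hs).trans hq)
    _ = (∑ s ∈ q.support, ‖coeff s q‖) * (1 + ‖w‖) ^ e := by rw [Finset.sum_mul]
    _ ≤ _ := mul_le_mul_of_nonneg_right (by linarith) (by positivity)

theorem exists_forall_norm_eval_le {σ : Type*} [Fintype σ] (q : σ → MvPolynomial σ ℂ) (e : σ → ℕ)
    (hq : ∀ j, (q j).totalDegree ≤ e j) :
    ∃ C : ℝ, 1 ≤ C ∧ ∀ j, ∀ w : σ → ℂ, ‖eval w (q j)‖ ≤ C * (1 + ‖w‖) ^ e j := by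
  choose C hC h using fun j => exists_norm_eval_le (q j) (e j) (hq j)
  have hnn : 0 ≤ ∑ j, C j := Finset.sum_nonneg fun j _ => (hC j).le
  refine ⟨1 + ∑ j, C j, by linarith, fun j w => (h j w).trans ?_⟩
  have h1 : C j ≤ ∑ j, C j := Finset.single_le_sum (fun j _ => (hC j).le) (Finset.mem_univ j)
  have hw := norm_nonneg w
  exact mul_le_mul_of_nonneg_right (by linarith) (by positivity)

/-- Quantitative form of the non-vanishing of the top homogeneous parts of the `q j`, `j ∈ J`, on
the coordinate subspace `{w | ∀ t ∉ S, w t = 0}`, in a conical neighbourhood of this subspace. -/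
theorem exists_le_norm_eval_of_top_nonvanishing {σ : Type*} [Fintype σ]
    (q : σ → MvPolynomial σ ℂ) (e : σ → ℕ) (he : ∀ j, 1 ≤ e j)
    (hq : ∀ j, (q j).totalDegree ≤ e j) (J S : Set σ)
    (hz : ∀ w : σ → ℂ, (∀ j ∈ J, eval w (homogeneousComponent (e j) (q j)) = 0) →
      (∀ t ∉ S, w t = 0) → w = 0) :
    ∃ δ c R : ℝ, 0 < δ ∧ δ < 1 ∧ 0 < c ∧ 1 ≤ R ∧ ∀ w : σ → ℂ, R ≤ ‖w‖ →
      (∀ t ∉ S, ‖w t‖ ≤ δ * ‖w‖) → ∃ j ∈ J, c * ‖w‖ ^ e j ≤ ‖eval w (q j)‖ := by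
  classical
  set h := fun j => homogeneousComponent (e j) (q j) with hh
  set Φ : (σ → ℂ) → ℝ := fun u =>
    (∑ j, if j ∈ J then ‖eval u (h j)‖ else 0) + ∑ t, if t ∈ S then 0 else ‖u t‖ with hΦ
  have hcont : Continuous Φ := by
    refine Continuous.add (continuous_finsetSum _ fun j _ => ?_)
      (continuous_finsetSum _ fun t _ => ?_)
    · split_ifs
      · exact (MvPolynomial.continuous_eval _).norm
      · exact continuous_const
    · split_ifs
      · exact continuous_const
      · exact (continuous_apply t).norm
  have hpos : ∀ u ∈ sphere (0 : σ → ℂ) 1, 0 < Φ u := by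
    intro u hu
    have h1 : ∀ j ∈ Finset.univ, 0 ≤ if j ∈ J then ‖eval u (h j)‖ else 0 := fun j _ => by
      split_ifs <;> simp
    have h2 : ∀ t ∈ Finset.univ, 0 ≤ if t ∈ S then 0 else ‖u t‖ := fun t _ => by
      split_ifs <;> simp
    rcases (add_nonneg (Finset.sum_nonneg h1) (Finset.sum_nonneg h2)).lt_or_eq with h0 | h0
    · exact h0
    exfalso
    obtain ⟨h3, h4⟩ := (add_eq_zero_iff_of_nonneg (Finset.sum_nonneg h1)
      (Finset.sum_nonneg h2)).1 h0.symm
    rw [Finset.sum_eq_zero_iff_of_nonneg h1] at h3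
    rw [Finset.sum_eq_zero_iff_of_nonneg h2] at h4
    have : u = 0 := hz u (fun j hj => by simpa [hj] using h3 j (Finset.mem_univ _))
      (fun t ht => by simpa [ht] using h4 t (Finset.mem_univ _))
    simp [this] at hu
  obtain ⟨μ, hμ, hμle⟩ : ∃ μ : ℝ, 0 < μ ∧ ∀ u ∈ sphere (0 : σ → ℂ) 1, μ ≤ Φ u := by
    rcases (sphere (0 : σ → ℂ) 1).eq_empty_or_nonempty with h0 | h0
    · exact ⟨1, one_pos, by simp [h0]⟩
    · obtain ⟨x, hx, hmin⟩ := (isCompact_sphere (0 : σ → ℂ) 1).exists_isMinOn h0 hcont.continuousOn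
      exact ⟨Φ x, hpos x hx, fun u hu => hmin hu⟩
  choose C hC hCle using fun j => exists_norm_eval_le (q j - h j) (e j - 1) (by
    have := totalDegree_sub_homogeneousComponent_lt (he j) (q j) (hq j)
    simp only [hh]; omega)
  set n : ℝ := (Fintype.card σ : ℝ) with hn
  have hn0 : 0 ≤ n := Nat.cast_nonneg _
  set c : ℝ := μ / (4 * (n + 1)) with hc
  have hc0 : 0 < c := by positivity
  have hSum : 0 ≤ ∑ j, C j * 2 ^ e j := Finset.sum_nonneg fun j _ => by
    have := hC j; positivity
  refine ⟨min (1 / 2) c, c, 1 + (∑ j, C j * 2 ^ e j) / c, by positivity,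
    (min_le_left _ _).trans_lt (by norm_num), hc0,
    by have : 0 ≤ (∑ j, C j * 2 ^ e j) / c := by positivity
       linarith, fun w hw hwS => ?_⟩
  have hw1 : 1 ≤ ‖w‖ := by
    have : 0 ≤ (∑ j, C j * 2 ^ e j) / c := by positivity
    linarith
  have hw0 : 0 < ‖w‖ := by linarith
  have hwR : ∑ j, C j * 2 ^ e j ≤ c * ‖w‖ := by
    rw [← div_le_iff₀' hc0]; linarith
  set u : σ → ℂ := ((‖w‖⁻¹ : ℝ) : ℂ) • w with hu
  have hwu : w = ((‖w‖ : ℝ) : ℂ) • u := by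
    rw [hu, smul_smul, ← Complex.ofReal_mul, mul_inv_cancel₀ hw0.ne']; simp
  have hus : u ∈ sphere (0 : σ → ℂ) 1 := by
    simp [hu, norm_smul, hw0.ne']
  have hΦu := hμle u hus
  have hS : ∑ t, (if t ∈ S then 0 else ‖u t‖) ≤ n * c := by
    have : ∀ t ∈ Finset.univ, (if t ∈ S then 0 else ‖u t‖) ≤ c := by
      intro t _
      split_ifs with ht
      · exact hc0.le
      · have h1 := hwS t ht
        have h2 : ‖u t‖ = ‖w‖⁻¹ * ‖w t‖ := by simp [hu]
        rw [h2, inv_mul_le_iff₀ hw0, mul_comm]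
        exact h1.trans (mul_le_mul_of_nonneg_right (min_le_right _ _) hw0.le)
    simpa [hn] using Finset.sum_le_card_nsmul _ _ _ this
  have hcn : 4 * ((n + 1) * c) = μ := by rw [hc]; field_simp
  obtain ⟨j, hj, hjle⟩ : ∃ j ∈ J, 2 * c ≤ ‖eval u (h j)‖ := by
    by_contra! hcon
    have : ∀ j ∈ Finset.univ, (if j ∈ J then ‖eval u (h j)‖ else 0) ≤ 2 * c := by
      intro j _
      split_ifs with hj
      · exact (hcon j hj).le
      · positivity
    have h1 := Finset.sum_le_card_nsmul _ _ _ this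
    rw [nsmul_eq_mul, Finset.card_univ] at h1
    simp only [hΦ] at hΦu
    nlinarith
  refine ⟨j, hj, ?_⟩
  have h1 : ‖eval w (h j)‖ = ‖w‖ ^ e j * ‖eval u (h j)‖ := by
    conv_lhs => rw [hwu]
    rw [eval_smul_of_isHomogeneous (homogeneousComponent_isHomogeneous _ _), norm_mul, norm_pow]
    simp [hh]
  have h2 := hCle j w
  have h3 : C j * (1 + ‖w‖) ^ (e j - 1) ≤ c * ‖w‖ ^ e j := by
    have hpow : (1 + ‖w‖) ^ (e j - 1) ≤ 2 ^ e j * ‖w‖ ^ (e j - 1) := by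
      calc (1 + ‖w‖) ^ (e j - 1) ≤ (2 * ‖w‖) ^ (e j - 1) := by gcongr; linarith
        _ = 2 ^ (e j - 1) * ‖w‖ ^ (e j - 1) := mul_pow _ _ _
        _ ≤ _ := by
          gcongr
          · norm_num
          · omega
    have hsing : C j * 2 ^ e j ≤ ∑ j, C j * 2 ^ e j :=
      Finset.single_le_sum (f := fun j => C j * 2 ^ e j)
        (fun j _ => by have := hC j; positivity) (Finset.mem_univ j)
    have hCj := hC j
    have hep : ‖w‖ ^ e j = ‖w‖ * ‖w‖ ^ (e j - 1) := by
      rw [← pow_succ', Nat.sub_add_cancel (he j)]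
    calc C j * (1 + ‖w‖) ^ (e j - 1) ≤ C j * (2 ^ e j * ‖w‖ ^ (e j - 1)) := by gcongr
      _ = (C j * 2 ^ e j) * ‖w‖ ^ (e j - 1) := by ring
      _ ≤ (c * ‖w‖) * ‖w‖ ^ (e j - 1) :=
        mul_le_mul_of_nonneg_right (hsing.trans hwR) (by positivity)
      _ = c * ‖w‖ ^ e j := by rw [hep]; ring
  have h4 : eval w (q j) = eval w (h j) + eval w (q j - h j) := by simp
  have h5 : ‖eval w (h j)‖ ≤ ‖eval w (q j)‖ + ‖eval w (q j - h j)‖ := by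
    rw [show eval w (h j) = eval w (q j) - eval w (q j - h j) by rw [h4]; ring]
    exact norm_sub_le _ _
  have h6 : ‖w‖ ^ e j * (2 * c) ≤ ‖eval w (h j)‖ := by rw [h1]; gcongr
  linarith

theorem exists_escape_step {κ : Type*} [Fintype κ] (Succ : (κ → ℂ) → (κ → ℂ) → Prop)
    (S : Set κ) {α β γ δ c C R : ℝ} (hα : 1 < α) (hαγ : α < γ) (hγβ : γ < β)
    (hδ : 0 < δ) (hc : 0 < c) (hC : 0 < C)
    (hup : ∀ w w', Succ w w' → ∀ t ∈ S, ‖w' t‖ ≤ C * (1 + ‖w‖) ^ α)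
    (hlow : ∀ w w', Succ w w' → R ≤ ‖w‖ → (∀ t ∈ S, ‖w t‖ ≤ δ * ‖w‖) →
      c * ‖w‖ ^ β ≤ 1 + ‖w'‖) :
    ∃ R' : ℝ, 2 ≤ R' ∧ ∀ w w', Succ w w' → R' ≤ ‖w‖ → (∀ t ∈ S, ‖w t‖ ≤ δ * ‖w‖) →
      ‖w‖ ^ γ ≤ ‖w'‖ ∧ ∀ t ∈ S, ‖w' t‖ ≤ δ * ‖w'‖ := by
  have h1 : ∀ᶠ x : ℝ in atTop, 2 / c ≤ x ^ (β - γ) :=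
    (tendsto_rpow_atTop (by linarith)).eventually_ge_atTop _
  have h2 : ∀ᶠ x : ℝ in atTop, C * 2 ^ α / δ ≤ x ^ (γ - α) :=
    (tendsto_rpow_atTop (by linarith)).eventually_ge_atTop _
  obtain ⟨R0, hR0⟩ := eventually_atTop.1 (h1.and h2)
  refine ⟨max (max 2 R) R0, (le_max_left _ _).trans (le_max_left _ _), fun w w' hs hw hwS => ?_⟩
  have hw2 : 2 ≤ ‖w‖ := ((le_max_left _ _).trans (le_max_left _ _)).trans hw
  have hwR : R ≤ ‖w‖ := ((le_max_right _ _).trans (le_max_left _ _)).trans hw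
  obtain ⟨h3, h4⟩ := hR0 ‖w‖ ((le_max_right _ _).trans hw)
  have hw0 : 0 < ‖w‖ := by linarith
  have hγ1 : 1 ≤ ‖w‖ ^ γ := Real.one_le_rpow (by linarith) (by linarith)
  have h5 : ‖w‖ ^ γ ≤ ‖w'‖ := by
    have h6 := hlow w w' hs hwR hwS
    have h7 : ‖w‖ ^ β = ‖w‖ ^ (β - γ) * ‖w‖ ^ γ := by
      rw [← Real.rpow_add hw0]; congr 1; ring
    rw [div_le_iff₀ hc] at h3
    have h8 : 2 * ‖w‖ ^ γ ≤ c * ‖w‖ ^ β := by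
      rw [h7]; nlinarith
    linarith
  refine ⟨h5, fun t ht => (hup w w' hs t ht).trans ?_⟩
  calc C * (1 + ‖w‖) ^ α ≤ C * (2 * ‖w‖) ^ α := by gcongr; linarith
    _ = (C * 2 ^ α) * ‖w‖ ^ α := by rw [Real.mul_rpow (by norm_num) hw0.le]; ring
    _ ≤ (δ * ‖w‖ ^ (γ - α)) * ‖w‖ ^ α := by
      rw [div_le_iff₀' hδ] at h4
      gcongr
    _ = δ * ‖w‖ ^ γ := by rw [mul_assoc, ← Real.rpow_add hw0]; congr 2; ring
    _ ≤ δ * ‖w'‖ := by gcongr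

/-- If orbits which enter a conical region at infinity escape at rate `β > α`, then orbits of
growth rate at most `α` satisfy a uniform growth bound. -/
theorem exists_log_growth_le {κ : Type*} [Fintype κ] (Succ : (κ → ℂ) → (κ → ℂ) → Prop)
    (S : Set κ) {α β δ c C R : ℝ} (hα : 1 < α) (hαβ : α < β)
    (hδ : 0 < δ) (hc : 0 < c) (hC : 0 < C)
    (hup : ∀ w w', Succ w w' → ∀ t ∈ S, ‖w' t‖ ≤ C * (1 + ‖w‖) ^ α)
    (hlow : ∀ w w', Succ w w' → R ≤ ‖w‖ → (∀ t ∈ S, ‖w t‖ ≤ δ * ‖w‖) →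
      c * ‖w‖ ^ β ≤ 1 + ‖w'‖) :
    ∃ E : ℝ, ∀ w : ℕ → κ → ℂ, (∀ n, Succ (w n) (w (n + 1))) →
      (∃ M : ℝ, ∀ n, Real.log (1 + ‖w n‖) ≤ M * α ^ n) →
      ∀ n, Real.log (1 + ‖w n‖) ≤ α ^ n * (Real.log (1 + ‖w 0‖) + E) := by
  obtain ⟨R', hR', hstep⟩ := exists_escape_step Succ S (γ := (α + β) / 2) hα (by linarith)
    (by linarith) hδ hc hC hup hlow
  set γ := (α + β) / 2 with hγ
  set E0 := 1 + R' + C / δ with hE0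
  have hE1 : 1 ≤ E0 := by have : 0 < C / δ := by positivity
                          linarith
  have hlogE : 0 ≤ Real.log E0 := Real.log_nonneg hE1
  have hα1 : 0 < α - 1 := by linarith
  refine ⟨Real.log E0 / (α - 1), fun w hw hM => ?_⟩
  obtain ⟨M, hM⟩ := hM
  have hnot : ∀ n, R' ≤ ‖w n‖ → ¬ ∀ t ∈ S, ‖w n t‖ ≤ δ * ‖w n‖ := by
    intro n0 hn0 hreg
    have hind : ∀ n, (R' ≤ ‖w (n0 + n)‖ ∧ ∀ t ∈ S, ‖w (n0 + n) t‖ ≤ δ * ‖w (n0 + n)‖) ∧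
        γ ^ n * Real.log R' ≤ Real.log ‖w (n0 + n)‖ := by
      intro n
      induction n with
      | zero => exact ⟨⟨hn0, hreg⟩, by simpa using Real.log_le_log (by linarith) hn0⟩
      | succ n ih =>
        obtain ⟨⟨h1, h2⟩, h3⟩ := ih
        obtain ⟨h4, h5⟩ := hstep _ _ (hw (n0 + n)) h1 h2
        have hpos : 0 < ‖w (n0 + n)‖ := by linarith
        have h6 : ‖w (n0 + n)‖ ≤ ‖w (n0 + n)‖ ^ γ := by
          conv_lhs => rw [← Real.rpow_one ‖w (n0 + n)‖]
          exact Real.rpow_le_rpow_of_exponent_le (by linarith) (by linarith)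
        refine ⟨⟨h1.trans (h6.trans h4), h5⟩, ?_⟩
        have h7 := Real.log_le_log (by positivity) h4
        rw [Real.log_rpow hpos] at h7
        calc γ ^ (n + 1) * Real.log R' = γ * (γ ^ n * Real.log R') := by ring
          _ ≤ γ * Real.log ‖w (n0 + n)‖ := by
            have : 0 ≤ γ := by linarith
            gcongr
          _ ≤ _ := h7
    have hbd : ∀ n, (γ / α) ^ n ≤ M * α ^ n0 / Real.log 2 := by
      intro n
      have hα0 : 0 < α ^ n := by positivity
      rw [div_pow, div_le_div_iff₀ hα0 (Real.log_pos (by norm_num))]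
      obtain ⟨⟨h1, -⟩, h3⟩ := hind n
      calc γ ^ n * Real.log 2 ≤ γ ^ n * Real.log R' := by
            have : 0 ≤ γ := by linarith
            gcongr
        _ ≤ Real.log ‖w (n0 + n)‖ := h3
        _ ≤ Real.log (1 + ‖w (n0 + n)‖) := Real.log_le_log (by linarith) (by linarith)
        _ ≤ M * α ^ (n0 + n) := hM _
        _ = M * α ^ n0 * α ^ n := by rw [pow_add]; ring
    have ht := tendsto_pow_atTop_atTop_of_one_lt
      (show 1 < γ / α by rw [one_lt_div (by linarith)]; linarith)
    obtain ⟨n, hn⟩ := (ht.eventually_gt_atTop (M * α ^ n0 / Real.log 2)).exists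
    exact absurd (hbd n) (not_le.2 hn)
  have hrec : ∀ n, Real.log (1 + ‖w (n + 1)‖) ≤ Real.log E0 + α * Real.log (1 + ‖w n‖) := by
    intro n
    have hn := norm_nonneg (w n)
    have hn1 := norm_nonneg (w (n + 1))
    have hge1 : 1 ≤ (1 + ‖w n‖) ^ α := Real.one_le_rpow (by linarith) (by linarith)
    have hkey : 1 + ‖w (n + 1)‖ ≤ E0 * (1 + ‖w n‖) ^ α := by
      have hCδ : 0 < C / δ := by positivity
      by_cases hcase : R' ≤ ‖w (n + 1)‖
      · have := hnot _ hcase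
        push Not at this
        obtain ⟨t, ht, hlt⟩ := this
        have h1 := hup _ _ (hw n) t ht
        have h2 : ‖w (n + 1)‖ ≤ C / δ * (1 + ‖w n‖) ^ α := by
          rw [div_mul_eq_mul_div, le_div_iff₀' hδ]
          linarith
        nlinarith
      · nlinarith
    rw [← Real.log_rpow (by linarith), ← Real.log_mul (by linarith) (by positivity)]
    exact Real.log_le_log (by linarith) hkey
  intro n
  have hstrong : Real.log (1 + ‖w n‖) ≤
      α ^ n * (Real.log (1 + ‖w 0‖) + Real.log E0 / (α - 1)) - Real.log E0 / (α - 1) := by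
    induction n with
    | zero => simp
    | succ n ih =>
      refine (hrec n).trans ?_
      have h1 : Real.log E0 = (α - 1) * (Real.log E0 / (α - 1)) := by field_simp
      have h2 := mul_le_mul_of_nonneg_left ih (show 0 ≤ α by linarith)
      rw [pow_succ]
      nlinarith
  have : 0 ≤ Real.log E0 / (α - 1) := by positivity
  linarith

/-- A function which is multiplied by `g` under a map `F`, and grows at most like a power of the
distance to an invariant compact set `K`, is Hölder at `K` as soon as `F` is `lam`-Lipschitz near
`K` with `lam ^ a ≤ g`. -/
theorem exists_le_infDist_rpow {X : Type*} [PseudoMetricSpace X] {K W T : Set X} {F : X → X}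
    {G : X → ℝ} {lam g a C₁ C₂ : ℝ} (hK : IsCompact K) (hKne : K.Nonempty) (hW : IsOpen W)
    (hKW : K ⊆ W) (hFK : MapsTo F K K) (hFT : MapsTo F T T)
    (hlam : 0 ≤ lam) (hF : ∀ u ∈ W, ∀ v ∈ W, dist (F u) (F v) ≤ lam * dist u v)
    (ha : 0 < a) (hg : 1 < g) (hlamg : lam ^ a ≤ g) (hG : ∀ z ∈ T, G (F z) = g * G z)
    (hC₁ : 0 ≤ C₁) (hC₂ : 0 ≤ C₂) (hbd : ∀ z ∈ T, G z ≤ C₁ + C₂ * infDist z K ^ a) :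
    ∃ c : ℝ, 0 < c ∧ ∀ z ∈ T, G z ≤ c * infDist z K ^ a := by
  obtain ⟨ε, hε, hεW⟩ := hK.exists_thickening_subset_open hW hKW
  have hεa : 0 < ε ^ a := Real.rpow_pos_of_pos hε a
  set c := 1 + C₁ / ε ^ a + C₂ with hc
  have hc0 : 0 < c := by positivity
  set M := C₁ + C₂ * ε ^ a with hM
  have hM0 : 0 ≤ M := by positivity
  refine ⟨c, hc0, ?_⟩
  have hfar : ∀ z ∈ T, ε ≤ infDist z K → G z ≤ c * infDist z K ^ a := by
    intro z hz hzε
    have h1 : ε ^ a ≤ infDist z K ^ a := Real.rpow_le_rpow hε.le hzε ha.le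
    have h2 : C₁ ≤ C₁ / ε ^ a * infDist z K ^ a := by
      rw [div_mul_eq_mul_div, le_div_iff₀ hεa]; gcongr
    have h3 := hbd z hz
    rw [hc]; nlinarith
  have hstep : ∀ z, infDist z K < ε → infDist (F z) K ≤ lam * infDist z K := by
    intro z hz
    obtain ⟨v, hv, hzv⟩ := hK.exists_infDist_eq_dist hKne z
    have hzW : z ∈ W := hεW ((mem_thickening_iff_infDist_lt hKne).2 hz)
    rw [hzv]
    exact (infDist_le_dist_of_mem (hFK hv)).trans (hF z hzW v (hKW hv))
  have hind : ∀ n : ℕ, ∀ z ∈ T, G z ≤ c * infDist z K ^ a + M * (1 / g) ^ n := by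
    intro n
    induction n with
    | zero =>
      intro z hz
      have h0 : 0 ≤ c * infDist z K ^ a := by have := infDist_nonneg (x := z) (s := K); positivity
      rcases le_or_gt ε (infDist z K) with h | h
      · simpa using (hfar z hz h).trans (le_add_of_nonneg_right hM0)
      · have h1 : infDist z K ^ a ≤ ε ^ a := Real.rpow_le_rpow infDist_nonneg h.le ha.le
        have h2 := hbd z hz
        have h3 := mul_le_mul_of_nonneg_left h1 hC₂
        simp only [pow_zero, mul_one]
        linarith
    | succ n ih =>
      intro z hz
      rcases le_or_gt ε (infDist z K) with h | h
      · exact (hfar z hz h).trans (le_add_of_nonneg_right (by positivity))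
      · have h1 := ih (F z) (hFT hz)
        rw [hG z hz] at h1
        have h2 : infDist (F z) K ^ a ≤ g * infDist z K ^ a := by
          calc infDist (F z) K ^ a ≤ (lam * infDist z K) ^ a :=
                Real.rpow_le_rpow infDist_nonneg (hstep z h) ha.le
            _ = lam ^ a * infDist z K ^ a := Real.mul_rpow hlam infDist_nonneg
            _ ≤ _ := mul_le_mul_of_nonneg_right hlamg (Real.rpow_nonneg infDist_nonneg _)
        have hg0 : 0 < g := by linarith
        have h3 : g * (c * infDist z K ^ a + M * (1 / g) ^ (n + 1)) =
            c * (g * infDist z K ^ a) + M * (1 / g) ^ n := by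
          rw [pow_succ]; field_simp
        refine le_of_mul_le_mul_left ?_ hg0
        rw [h3]
        have := mul_le_mul_of_nonneg_left h2 hc0.le
        linarith
  intro z hz
  have ht : Tendsto (fun n : ℕ => c * infDist z K ^ a + M * (1 / g) ^ n) atTop
      (𝓝 (c * infDist z K ^ a + M * 0)) :=
    tendsto_const_nhds.add ((tendsto_pow_atTop_nhds_zero_of_lt_one (by positivity)
      (by rw [div_lt_one] <;> linarith)).const_mul M)
  simpa using ge_of_tendsto' ht fun n => hind n z hz

theorem le_mul_rpow_div_of_pow_le {x y C : ℝ} {p d : ℕ} (hy : 1 ≤ y) (hC : 1 ≤ C)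
    (hp : 1 ≤ p) (h : x ^ p ≤ C * y ^ d) : x ≤ C * y ^ ((d : ℝ) / p) := by
  have hy0 : 0 ≤ y := by linarith
  have hpp : (p : ℝ) ≠ 0 := by positivity
  refine le_of_pow_le_pow_left₀ (by omega : p ≠ 0) (by positivity) ?_
  rw [mul_pow, ← Real.rpow_natCast (y ^ ((d : ℝ) / p)), ← Real.rpow_mul hy0,
    div_mul_cancel₀ _ hpp, Real.rpow_natCast]
  exact h.trans (mul_le_mul_of_nonneg_right (le_self_pow₀ hC (by omega)) (by positivity))

theorem mul_rpow_div_le_of_le_pow {x y c : ℝ} {p d : ℕ} (hx : 0 ≤ x) (hy : 0 ≤ y) (hc : 0 ≤ c)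
    (hc1 : c ≤ 1) (hp : 1 ≤ p) (h : c * y ^ d ≤ x ^ p) : c * y ^ ((d : ℝ) / p) ≤ x := by
  have hpp : (p : ℝ) ≠ 0 := by positivity
  refine le_of_pow_le_pow_left₀ (by omega : p ≠ 0) hx ?_
  rw [mul_pow, ← Real.rpow_natCast (y ^ ((d : ℝ) / p)), ← Real.rpow_mul hy,
    div_mul_cancel₀ _ hpp, Real.rpow_natCast]
  exact le_trans (mul_le_mul_of_nonneg_right (pow_le_of_le_one hc hc1 (by omega)) (by positivity)) h

section Block

variable {κ : Type*} [Fintype κ]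

theorem exists_coord_pow_le (pi : κ → MvPolynomial κ ℂ) (B : κ → ℕ) (p : ℕ → ℕ)
    (hp : ∀ j, 1 ≤ p (B j))
    (hblock : ∀ j, ∀ s ∈ (pi j).support, ∀ t, s t ≠ 0 → B t = B j)
    (hdeg : ∀ j, (pi j).totalDegree ≤ p (B j))
    (htop : ∀ r, ∀ w : κ → ℂ, (∀ j, B j = B r →
      eval w (homogeneousComponent (p (B j)) (pi j)) = 0) → ∀ j, B j = B r → w j = 0) :
    ∃ C : ℝ, 1 ≤ C ∧ ∀ (w : κ → ℂ) (j : κ),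
      ∃ t, B t = B j ∧ ‖w j‖ ^ p (B j) ≤ C * (1 + ‖eval w (pi t)‖) := by
  classical
  have hmain : ∀ r : κ, ∃ C : ℝ, 0 < C ∧ ∀ w : κ → ℂ,
      ∃ t, B t = B r ∧ ‖w r‖ ^ p (B r) ≤ C * (1 + ‖eval w (pi t)‖) := by
    intro r
    obtain ⟨δ, c, R, hδ, -, hc, hR, h⟩ := exists_le_norm_eval_of_top_nonvanishing pi
      (fun j => p (B j)) hp hdeg {j | B j = B r} {j | B j = B r} (fun w h1 h2 => by
        funext t
        by_cases ht : B t = B r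
        · exact htop r w h1 t ht
        · exact h2 t ht)
    refine ⟨1 / c + R ^ p (B r), by positivity, fun w => ?_⟩
    set v : κ → ℂ := fun t => if B t = B r then w t else 0 with hv
    have hwv : ‖w r‖ ≤ ‖v‖ := by simpa [hv] using norm_le_pi_norm v r
    rcases le_or_gt R ‖v‖ with hRv | hRv
    · obtain ⟨t, ht, hle⟩ := h v hRv fun t ht => by
        have hvt : v t = 0 := if_neg ht
        rw [hvt, norm_zero]; positivity
      have ht' : B t = B r := ht
      have heq : eval v (pi t) = eval w (pi t) := by
        rw [eval_eq, eval_eq]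
        refine Finset.sum_congr rfl fun s hs => ?_
        congr 1
        refine Finset.prod_congr rfl fun u hu => ?_
        have : B u = B r := (hblock t s hs u (Finsupp.mem_support_iff.1 hu)).trans ht'
        simp [hv, this]
      rw [heq, ht'] at hle
      refine ⟨t, ht', ?_⟩
      have h1 : ‖w r‖ ^ p (B r) ≤ ‖v‖ ^ p (B r) := by gcongr
      have h2 : ‖v‖ ^ p (B r) ≤ 1 / c * ‖eval w (pi t)‖ := by
        rw [one_div, ← div_eq_inv_mul, le_div_iff₀' hc]; exact hle
      have h3 : 0 ≤ R ^ p (B r) * (1 + ‖eval w (pi t)‖) := by positivity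
      have h4 : 0 < 1 / c := by positivity
      linarith
    · refine ⟨r, rfl, ?_⟩
      have h1 : ‖w r‖ ^ p (B r) ≤ R ^ p (B r) := by gcongr; linarith
      have h2 : 0 ≤ 1 / c * (1 + ‖eval w (pi r)‖) := by positivity
      have h3 : 0 ≤ R ^ p (B r) * ‖eval w (pi r)‖ := by positivity
      linarith
  choose C hC h using hmain
  have hnn : 0 ≤ ∑ j, C j := Finset.sum_nonneg fun j _ => (hC j).le
  refine ⟨1 + ∑ j, C j, by linarith, fun w j => ?_⟩
  obtain ⟨t, ht, hle⟩ := h j w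
  refine ⟨t, ht, hle.trans ?_⟩
  have h1 : C j ≤ ∑ j, C j := Finset.single_le_sum (fun j _ => (hC j).le) (Finset.mem_univ j)
  exact mul_le_mul_of_nonneg_right (by linarith) (by positivity)

/-- Uniform growth bound, in the coordinates upstairs of `pi`, for the orbits of a `pi`-regular map
whose growth rate is at most `α_i`. -/
theorem exists_log_orbit_le (P pi : κ → MvPolynomial κ ℂ) (B : κ → ℕ) (p dpi : ℕ → ℕ) (m : ℕ)
    (hB : ∀ j, 1 ≤ B j ∧ B j ≤ m)
    (hp : ∀ i, 1 ≤ i → i ≤ m → 1 ≤ p i) (hd : ∀ i, 1 ≤ i → i ≤ m → 1 ≤ dpi i)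
    (hblock : ∀ j, ∀ s ∈ (pi j).support, ∀ t, s t ≠ 0 → B t = B j)
    (hpideg : ∀ j, (pi j).totalDegree ≤ p (B j))
    (htop : ∀ r, ∀ w : κ → ℂ, (∀ j, B j = B r →
      eval w (homogeneousComponent (p (B j)) (pi j)) = 0) → ∀ j, B j = B r → w j = 0)
    (hdeg : ∀ j, (aeval pi (P j)).totalDegree ≤ dpi (B j))
    (hreg : ∀ i, 1 ≤ i → i ≤ m → ∀ w : κ → ℂ,
      (∀ j, B j ≤ i → eval w (homogeneousComponent (dpi (B j)) (aeval pi (P j))) = 0) →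
      (∀ j, i < B j → w j = 0) → w = 0)
    (hanti : ∀ i j, 1 ≤ i → i < j → j ≤ m → alphaR p dpi j < alphaR p dpi i)
    (i : ℕ) (hi1 : 1 ≤ i) (him : i ≤ m) (hα : 1 < alphaR p dpi i) :
    ∃ E : ℝ, ∀ w : ℕ → κ → ℂ,
      (∀ n, ∀ j, eval (w (n + 1)) (pi j) = eval (w n) (aeval pi (P j))) →
      (∃ M : ℝ, ∀ n, Real.log (1 + ‖w n‖) ≤ M * alphaR p dpi i ^ n) →
      ∀ n, Real.log (1 + ‖w n‖) ≤ alphaR p dpi i ^ n * (Real.log (1 + ‖w 0‖) + E) := by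
  have hpB : ∀ j, 1 ≤ p (B j) := fun j => hp _ (hB j).1 (hB j).2
  have hle : ∀ i j, 1 ≤ i → i ≤ j → j ≤ m → alphaR p dpi j ≤ alphaR p dpi i := fun i j h1 h2 h3 =>
    h2.lt_or_eq.elim (fun h => (hanti i j h1 h h3).le) fun h => by rw [h]
  obtain ⟨C₁, hC₁, hcoord⟩ := exists_coord_pow_le pi B p hpB hblock hpideg htop
  obtain ⟨C₂, hC₂, hPup⟩ := exists_forall_norm_eval_le _ _ hdeg
  obtain ⟨C₃, hC₃, hpiup⟩ := exists_forall_norm_eval_le _ _ hpideg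
  set Succ : (κ → ℂ) → (κ → ℂ) → Prop :=
    fun w w' => ∀ j, eval w' (pi j) = eval w (aeval pi (P j)) with hSucc
  have hup : ∀ w w', Succ w w' → ∀ t ∈ {t | i ≤ B t},
      ‖w' t‖ ≤ C₁ * (1 + C₂) * (1 + ‖w‖) ^ alphaR p dpi i := by
    intro w w' hs t ht
    have hw := norm_nonneg w
    have h1 : ‖w' t‖ ^ p (B t) ≤ C₁ * (1 + C₂) * (1 + ‖w‖) ^ dpi (B t) := by
      obtain ⟨u, hu, hle⟩ := hcoord w' t
      have h2 := hPup u w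
      rw [hs u] at hle
      rw [hu] at h2
      have h3 : 1 ≤ (1 + ‖w‖) ^ dpi (B t) := one_le_pow₀ (by linarith)
      rw [mul_assoc]
      refine hle.trans (mul_le_mul_of_nonneg_left ?_ (by linarith))
      linarith
    refine (le_mul_rpow_div_of_pow_le (by linarith) (by nlinarith) (hpB t) h1).trans ?_
    have h4 : ((dpi (B t) : ℝ) / p (B t)) ≤ alphaR p dpi i := hle i (B t) hi1 ht (hB t).2
    refine mul_le_mul_of_nonneg_left ?_ (by nlinarith)
    exact Real.rpow_le_rpow_of_exponent_le (by linarith) h4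
  obtain ⟨β, δ, c, R, hβ, hδ, hc, hlow⟩ : ∃ β δ c R : ℝ, alphaR p dpi i < β ∧ 0 < δ ∧ 0 < c ∧
      ∀ w w', Succ w w' → R ≤ ‖w‖ → (∀ t ∈ {t | i ≤ B t}, ‖w t‖ ≤ δ * ‖w‖) →
      c * ‖w‖ ^ β ≤ 1 + ‖w'‖ := by
    rcases hi1.eq_or_lt with rfl | hi2
    · refine ⟨alphaR p dpi 1 + 1, 1 / 2, 1, 1, by linarith, by norm_num, one_pos, ?_⟩
      intro w w' _ hw hwS
      have := (pi_norm_le_iff_of_nonneg (by positivity)).2 fun t => hwS t (hB t).1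
      linarith
    obtain ⟨δ, c, R, hδ, -, hc, hR, h⟩ := exists_le_norm_eval_of_top_nonvanishing
      (fun j => aeval pi (P j)) (fun j => dpi (B j)) (fun j => hd _ (hB j).1 (hB j).2) hdeg
      {j | B j ≤ i - 1} {j | B j ≤ i - 1} fun w h1 h2 =>
        hreg (i - 1) (by omega) (by omega) w h1 fun j hj => h2 j (not_le.2 hj)
    have hcC : 0 < c / C₃ := by positivity
    refine ⟨alphaR p dpi (i - 1), δ, min 1 (c / C₃), R,
      hanti _ _ (by omega) (by omega) him, hδ, by positivity, fun w w' hs hw hwS => ?_⟩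
    obtain ⟨j, hj, hjle⟩ := h w hw fun t ht => hwS t (by
      have : ¬ B t ≤ i - 1 := ht
      show i ≤ B t
      omega)
    have hw1 : 1 ≤ ‖w‖ := hR.trans hw
    have hw' := norm_nonneg w'
    have h1 : min 1 (c / C₃) * ‖w‖ ^ dpi (B j) ≤ (1 + ‖w'‖) ^ p (B j) := by
      have h2 := hpiup j w'
      rw [hs j] at h2
      have h3 : c / C₃ * ‖w‖ ^ dpi (B j) ≤ (1 + ‖w'‖) ^ p (B j) := by
        rw [div_mul_eq_mul_div, div_le_iff₀' (by linarith)]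
        exact hjle.trans h2
      exact (mul_le_mul_of_nonneg_right (min_le_right _ _) (by positivity)).trans h3
    have h4 := mul_rpow_div_le_of_le_pow (by linarith) (by linarith) (by positivity)
      (min_le_left _ _) (hpB j) h1
    refine le_trans (mul_le_mul_of_nonneg_left ?_ (by positivity)) h4
    exact Real.rpow_le_rpow_of_exponent_le hw1
      (hle (B j) (i - 1) (hB j).1 hj (by omega))
  exact exists_log_growth_le Succ {t | i ≤ B t} hα hβ hδ hc (by positivity) hup hlow

end Block

/-- Near a nonempty compact set `log (1 + ‖z‖)` is controlled by any positive power of the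
distance to it. -/
theorem exists_log_one_add_norm_le_infDist_rpow {X : Type*} [NormedAddCommGroup X] {K : Set X}
    (hK : IsCompact K) (hKne : K.Nonempty) {a : ℝ} (ha : 0 < a) :
    ∃ C : ℝ, 0 ≤ C ∧ ∀ z, Real.log (1 + ‖z‖) ≤ C + a⁻¹ * infDist z K ^ a := by
  obtain ⟨b, hb⟩ := hK.isBounded.exists_norm_le
  have hb0 : 0 ≤ b := (norm_nonneg _).trans (hb _ hKne.some_mem)
  refine ⟨Real.log (1 + b) + Real.log 2, add_nonneg (Real.log_nonneg (by linarith))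
    (Real.log_nonneg (by norm_num)), fun z => ?_⟩
  obtain ⟨y, hy, hzy⟩ := hK.exists_infDist_eq_dist hKne z
  set x := infDist z K
  have hx : 0 ≤ x := infDist_nonneg
  have hz : ‖z‖ ≤ b + x := by
    have h1 : ‖z‖ ≤ ‖y‖ + ‖z - y‖ := by simpa using norm_add_le y (z - y)
    rw [← dist_eq_norm, ← hzy] at h1
    linarith [hb y hy]
  have h1 : Real.log (1 + ‖z‖) ≤ Real.log (1 + b) + Real.log (1 + x) := by
    rw [← Real.log_mul (by positivity) (by positivity)]
    refine Real.log_le_log (by positivity) ?_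
    nlinarith
  have h2 : Real.log (1 + x) ≤ Real.log 2 + a⁻¹ * x ^ a := by
    have hpow : 0 ≤ a⁻¹ * x ^ a := by positivity
    rcases le_total x 1 with h | h
    · have := Real.log_le_log (by positivity) (by linarith : 1 + x ≤ 2)
      linarith
    · have h3 := Real.log_le_log (by positivity) (by linarith : 1 + x ≤ 2 * x)
      rw [Real.log_mul (by norm_num) (by positivity)] at h3
      have h4 := Real.log_le_rpow_div hx ha
      rw [div_eq_inv_mul] at h4
      linarith
  linarith

theorem logPlus_nonneg (x : ℝ) : 0 ≤ logPlus x := le_max_right _ _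

theorem log_one_add_le_logPlus {x : ℝ} (hx : 0 ≤ x) :
    Real.log (1 + x) ≤ Real.log 2 + logPlus x := by
  rcases le_total x 1 with h | h
  · have := Real.log_le_log (by positivity) (by linarith : 1 + x ≤ 2)
    linarith [logPlus_nonneg x]
  · have h3 := Real.log_le_log (by positivity) (by linarith : 1 + x ≤ 2 * x)
    rw [Real.log_mul (by norm_num) (by positivity)] at h3
    exact h3.trans (by gcongr; exact le_max_left _ _)

theorem logPlus_le_log {x y : ℝ} (hx : 0 ≤ x) (hy : 1 ≤ y) (h : x ≤ y) :
    logPlus x ≤ Real.log y := by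
  refine max_le ?_ (Real.log_nonneg hy)
  rcases hx.eq_or_lt with rfl | hx
  · simpa using Real.log_nonneg hy
  · exact Real.log_le_log hx h

section

variable {k : ℕ}

theorem eval_aeval_eq (w : Fin k → ℂ) (pi : Fin k → MvPolynomial (Fin k) ℂ)
    (q : MvPolynomial (Fin k) ℂ) :
    eval w (aeval pi q) = eval (fun t => eval w (pi t)) q := by
  rw [aeval_def, eval_eval₂, eval_eq', eval₂_eq']
  simp

theorem exists_logPlus_norm_le (q : Fin k → MvPolynomial (Fin k) ℂ) :
    ∃ A D : ℝ, 0 ≤ A ∧ 0 ≤ D ∧ ∀ (w : Fin k → ℂ) (z : EuclideanSpace ℂ (Fin k)),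
      (∀ j, z j = eval w (q j)) → logPlus ‖z‖ ≤ A + D * Real.log (1 + ‖w‖) := by
  obtain ⟨C, hC, h⟩ := exists_forall_norm_eval_le q
    (fun _ => Finset.univ.sup fun j => (q j).totalDegree)
    fun j => Finset.le_sup (f := fun j => (q j).totalDegree) (Finset.mem_univ j)
  set D := Finset.univ.sup fun j => (q j).totalDegree
  refine ⟨Real.log ((k + 1) * C), D, Real.log_nonneg ?_, by positivity, fun w z hz => ?_⟩
  · nlinarith [(Nat.cast_nonneg k : (0 : ℝ) ≤ k)]
  have hk0 : (0 : ℝ) ≤ k := Nat.cast_nonneg k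
  have hw1 : 1 ≤ (1 + ‖w‖) ^ D := one_le_pow₀ (by linarith [norm_nonneg w])
  have hCw : 1 ≤ C * (1 + ‖w‖) ^ D := by nlinarith
  have hnorm : ‖z‖ ≤ (k + 1) * C * (1 + ‖w‖) ^ D := by
    have hz1 : ‖z‖ ≤ ∑ j, ‖z j‖ := by
      conv_lhs => rw [← (EuclideanSpace.basisFun (Fin k) ℂ).sum_repr z]
      refine (norm_sum_le _ _).trans (Finset.sum_le_sum fun j _ => ?_)
      simp [norm_smul]
    have hz2 : ∑ j, ‖z j‖ ≤ ∑ _j : Fin k, C * (1 + ‖w‖) ^ D :=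
      Finset.sum_le_sum fun j _ => by rw [hz j]; exact h j w
    simp only [Finset.sum_const, Finset.card_univ, Fintype.card_fin, nsmul_eq_mul] at hz2
    nlinarith
  have := logPlus_le_log (norm_nonneg z) (by nlinarith) hnorm
  rwa [Real.log_mul (by positivity) (by positivity), Real.log_pow] at this

/-- A split polynomial map does not contract in logarithmic scale. -/
theorem exists_log_norm_le_of_split (pi : Fin k → MvPolynomial (Fin k) ℂ) (B : Fin k → ℕ)
    (p : ℕ → ℕ) (hp : ∀ j, 1 ≤ p (B j))
    (hblock : ∀ j, ∀ s ∈ (pi j).support, ∀ t, s t ≠ 0 → B t = B j)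
    (hdeg : ∀ j, (pi j).totalDegree ≤ p (B j))
    (htop : ∀ r, ∀ w : Fin k → ℂ, (∀ j, B j = B r →
      eval w (homogeneousComponent (p (B j)) (pi j)) = 0) → ∀ j, B j = B r → w j = 0) :
    ∃ A : ℝ, 0 ≤ A ∧ ∀ (w : Fin k → ℂ) (z : EuclideanSpace ℂ (Fin k)),
      (∀ j, z j = eval w (pi j)) → Real.log (1 + ‖w‖) ≤ A + Real.log (1 + ‖z‖) := by
  obtain ⟨C, hC, h⟩ := exists_coord_pow_le pi B p hp hblock hdeg htop
  refine ⟨Real.log (C + 2), Real.log_nonneg (by linarith), fun w z hz => ?_⟩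
  have hz0 := norm_nonneg z
  have hw : ‖w‖ ≤ C * (1 + ‖z‖) + 1 := by
    refine (pi_norm_le_iff_of_nonneg (by positivity)).2 fun j => ?_
    obtain ⟨t, -, ht⟩ := h w j
    rw [← hz t] at ht
    have hzt : ‖z t‖ ≤ ‖z‖ := PiLp.norm_apply_le z t
    rcases le_total ‖w j‖ 1 with h1 | h1
    · nlinarith
    · have := le_self_pow₀ h1 (Nat.one_le_iff_ne_zero.1 (hp j))
      nlinarith
  rw [← Real.log_mul (by positivity) (by positivity)]
  exact Real.log_le_log (by positivity) (by nlinarith)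

/-- The sets `K_i` are forward invariant. -/
theorem mapsTo_kSetPi (f : EuclideanSpace ℂ (Fin k) → EuclideanSpace ℂ (Fin k))
    (P : Fin k → MvPolynomial (Fin k) ℂ) (p : ℕ → ℕ) (B : Fin k → ℕ) (dpi l : ℕ → ℕ) (i : ℕ) :
    MapsTo f (kSetPi k f P p B dpi l i) (kSetPi k f P p B dpi l i) := by
  intro z hz j hj hji hmem
  refine hz j hj hji ⟨?_, ?_⟩
  · exact (tendsto_add_atTop_iff_nat 1).1 hmem.1
  · exact (tendsto_add_atTop_iff_nat 1).1 hmem.2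

/-- On its domain, the Green function of a `pi`-regular map grows at most logarithmically. -/
theorem exists_green_le (P pi : Fin k → MvPolynomial (Fin k) ℂ) (B : Fin k → ℕ) (p dpi : ℕ → ℕ)
    (m : ℕ) (hB : ∀ j, 1 ≤ B j ∧ B j ≤ m)
    (hp : ∀ i, 1 ≤ i → i ≤ m → 1 ≤ p i) (hd : ∀ i, 1 ≤ i → i ≤ m → 1 ≤ dpi i)
    (hblock : ∀ j, ∀ s ∈ (pi j).support, ∀ t, s t ≠ 0 → B t = B j)
    (hpideg : ∀ j, (pi j).totalDegree ≤ p (B j))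
    (htop : ∀ r, ∀ w : Fin k → ℂ, (∀ j, B j = B r →
      eval w (homogeneousComponent (p (B j)) (pi j)) = 0) → ∀ j, B j = B r → w j = 0)
    (hdeg : ∀ j, (aeval pi (P j)).totalDegree ≤ dpi (B j))
    (hreg : ∀ i, 1 ≤ i → i ≤ m → ∀ w : Fin k → ℂ,
      (∀ j, B j ≤ i → eval w (homogeneousComponent (dpi (B j)) (aeval pi (P j))) = 0) →
      (∀ j, i < B j → w j = 0) → w = 0)
    (hanti : ∀ i j, 1 ≤ i → i < j → j ≤ m → alphaR p dpi j < alphaR p dpi i)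
    (f : EuclideanSpace ℂ (Fin k) → EuclideanSpace ℂ (Fin k))
    (hf : ∀ (z : EuclideanSpace ℂ (Fin k)) (j : Fin k), f z j = eval (fun t => z t) (P j))
    (i : ℕ) (hi1 : 1 ≤ i) (him : i ≤ m) (hα : 1 < alphaR p dpi i) :
    ∃ C₁ C₂ : ℝ, 0 ≤ C₁ ∧ 0 ≤ C₂ ∧ ∀ (z : EuclideanSpace ℂ (Fin k)) (g : ℝ),
      Tendsto (fun n : ℕ => (alphaR p dpi i ^ n)⁻¹ * logPlus ‖f^[n] z‖) atTop (𝓝 g) →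
      g ≤ C₁ + C₂ * Real.log (1 + ‖z‖) := by
  obtain ⟨E, hE⟩ := exists_log_orbit_le P pi B p dpi m hB hp hd hblock hpideg htop hdeg hreg
    hanti i hi1 him hα
  have hpB : ∀ j, 1 ≤ p (B j) := fun j => hp _ (hB j).1 (hB j).2
  obtain ⟨A, hA, hlow⟩ := exists_log_norm_le_of_split pi B p hpB hblock hpideg htop
  obtain ⟨A', D, hA', hD, hup⟩ := exists_logPlus_norm_le pi
  set α := alphaR p dpi i
  have hα0 : 0 < α := by linarith
  have hsurj : ∀ z : EuclideanSpace ℂ (Fin k), ∃ w : Fin k → ℂ, ∀ j, eval w (pi j) = z j :=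
    fun z => exists_eval_eq_of_top_nonvanishing pi (fun j => p (B j)) hpB hpideg
      (fun w hw => funext fun j => htop j w (fun t _ => hw t) j rfl) z
  choose s hs using hsurj
  refine ⟨A' + D * (A + |E|), D, by positivity, hD, fun z g hg => ?_⟩
  have hα_pow : ∀ n : ℕ, 1 ≤ α ^ n := fun n => one_le_pow₀ hα.le
  have hbd := hE (fun n => s (f^[n] z)) (fun n j => by
      rw [hs, Function.iterate_succ_apply', hf, eval_aeval_eq]
      simp only [hs]) (by
    obtain ⟨M, hM⟩ := hg.bddAbove_range
    refine ⟨A + Real.log 2 + M, fun n => ?_⟩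
    have h1 := hlow (s (f^[n] z)) (f^[n] z) fun j => (hs _ j).symm
    have h2 := log_one_add_le_logPlus (norm_nonneg (f^[n] z))
    have h3 : (α ^ n)⁻¹ * logPlus ‖f^[n] z‖ ≤ M := hM ⟨n, rfl⟩
    rw [inv_mul_le_iff₀ (by positivity)] at h3
    have h4 : 0 ≤ Real.log 2 := Real.log_nonneg (by norm_num)
    nlinarith [hα_pow n])
  refine le_of_tendsto' hg fun n => ?_
  have h1 := hup (s (f^[n] z)) (f^[n] z) fun j => (hs _ j).symm
  have h2 := hlow (s z) z fun j => (hs _ j).symm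
  have h3 : Real.log (1 + ‖s (f^[n] z)‖) ≤ α ^ n * (A + |E| + Real.log (1 + ‖z‖)) := by
    refine (hbd n).trans (mul_le_mul_of_nonneg_left ?_ (by positivity))
    simp only [Function.iterate_zero, id]
    linarith [le_abs_self E]
  rw [inv_mul_le_iff₀ (by positivity)]
  have h5 := mul_le_mul_of_nonneg_left h3 hD
  nlinarith [hα_pow n]

/-- A `pi`-regular map of large enough degrees has a fixed point. -/
theorem exists_fixedPoint_of_regular (P pi : Fin k → MvPolynomial (Fin k) ℂ) (e : Fin k → ℕ)
    (hlt : ∀ j, (pi j).totalDegree < e j) (hdeg : ∀ j, (aeval pi (P j)).totalDegree ≤ e j)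
    (hreg : ∀ w : Fin k → ℂ,
      (∀ j, eval w (homogeneousComponent (e j) (aeval pi (P j))) = 0) → w = 0)
    (f : EuclideanSpace ℂ (Fin k) → EuclideanSpace ℂ (Fin k))
    (hf : ∀ (z : EuclideanSpace ℂ (Fin k)) (j : Fin k), f z j = eval (fun t => z t) (P j)) :
    ∃ z, Function.IsFixedPt f z := by
  obtain ⟨w, hw⟩ := exists_eval_eq_of_top_nonvanishing (fun j => aeval pi (P j) - pi j) e
    (fun j => (Nat.zero_le _).trans_lt (hlt j))
    (fun j => (totalDegree_sub _ _).trans (max_le (hdeg j) (hlt j).le))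
    (fun w h => hreg w fun j => by
      have := h j
      rwa [map_sub, homogeneousComponent_eq_zero _ _ (hlt j), sub_zero] at this) 0
  refine ⟨WithLp.toLp 2 fun j => eval w (pi j), ?_⟩
  ext j
  have := hw j
  simp only [map_sub, Pi.zero_apply, sub_eq_zero] at this
  rw [hf]
  exact (eval_aeval_eq w pi (P j)).symm.trans this

end

/-- (Proposition 3.8, part 1.) Let `f` be an open `π`-regular
polynomial map with `α_m > 1`, with partial Green functions `G_i` (limits of the
`G_{i,n}` on `K_{i−1}`, invariant `G_i∘f = α_i G_i`, vanishing on the compact set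
`K = K_m` of bounded orbits). Let `W` be a bounded open neighborhood of `K`, and
`N ≥ 1`, `L > 1` with `‖f^N(u) − f^N(v)‖ ≤ L^N ‖u − v‖` on `W`. Then for every
`1 ≤ i ≤ m` and `0 < a < log α_i / log L` there is `c > 0` with
`G_i(z) ≤ c · dist(z,K)^a` on `K_{i−1}`. -/
theorem stmt15 (k m : ℕ) (hk : 0 < k) (hm : 1 ≤ m)
    (l : ℕ → ℕ) (hl0 : l 0 = 0) (hlm : l m = k)
    (hlmono : ∀ i < m, l i < l (i + 1))
    (P : Fin k → MvPolynomial (Fin k) ℂ)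
    (d : ℕ → ℕ)
    (hdeg : ∀ i, 1 ≤ i → i ≤ m → ∀ j : Fin k,
      l (i - 1) ≤ (j : ℕ) → (j : ℕ) < l i → (P j).totalDegree = d i)
    (hdmono : ∀ i, 1 ≤ i → i < m → d (i + 1) < d i)
    (hdm : 1 ≤ d m)
    (p : ℕ → ℕ) (hp1 : 1 ≤ p 1)
    (hpmono : ∀ i, 1 ≤ i → i < m → p i ≤ p (i + 1))
    (B : Fin k → ℕ)
    (hB : ∀ j : Fin k, 1 ≤ B j ∧ B j ≤ m ∧ l (B j - 1) ≤ (j : ℕ) ∧ (j : ℕ) < l (B j))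
    (pi : Fin k → MvPolynomial (Fin k) ℂ)
    (hpiblock : ∀ j : Fin k, ∀ s ∈ (pi j).support, ∀ t : Fin k,
      s t ≠ 0 → l (B j - 1) ≤ (t : ℕ) ∧ (t : ℕ) < l (B j))
    (hpideg : ∀ j : Fin k, (pi j).totalDegree ≤ p (B j))
    (hpitop : ∀ i, 1 ≤ i → i ≤ m → ∀ w : Fin k → ℂ,
      (∀ j : Fin k, l (i - 1) ≤ (j : ℕ) → (j : ℕ) < l i →
        eval w (homogeneousComponent (p i) (pi j)) = 0) →
      ∀ j : Fin k, l (i - 1) ≤ (j : ℕ) → (j : ℕ) < l i → w j = 0)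
    (dpi : ℕ → ℕ)
    (hdpi : ∀ i, 1 ≤ i → i ≤ m →
      (∀ j : Fin k, l (i - 1) ≤ (j : ℕ) → (j : ℕ) < l i →
        (aeval pi (P j)).totalDegree ≤ dpi i) ∧
      ∃ j : Fin k, l (i - 1) ≤ (j : ℕ) ∧ (j : ℕ) < l i ∧
        (aeval pi (P j)).totalDegree = dpi i)
    (hdpimono : ∀ i, 1 ≤ i → i < m → dpi (i + 1) < dpi i)
    (hpireg : ∀ i, 1 ≤ i → i ≤ m → ∀ z : Fin k → ℂ,
      (∀ r, 1 ≤ r → r ≤ i → ∀ j : Fin k, l (r - 1) ≤ (j : ℕ) → (j : ℕ) < l r →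
        eval z (homogeneousComponent (dpi r) (aeval pi (P j))) = 0) →
      (∀ j : Fin k, l i ≤ (j : ℕ) → z j = 0) → z = 0)
    (halpha : 1 < alphaR p dpi m)
    (f : EuclideanSpace ℂ (Fin k) → EuclideanSpace ℂ (Fin k))
    (hf : ∀ (z : EuclideanSpace ℂ (Fin k)) (j : Fin k),
      f z j = eval (fun t => z t) (P j))
    (hopen : IsOpenMap f)
    (G : ℕ → EuclideanSpace ℂ (Fin k) → ℝ)
    (hGlim : ∀ i, 1 ≤ i → i ≤ m → ∀ z ∈ kSetPi k f P p B dpi l (i - 1),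
      Tendsto (fun n : ℕ => (alphaR p dpi i ^ n)⁻¹ * logPlus ‖f^[n] z‖)
        atTop (𝓝 (G i z)) ∧
      G i (f z) = alphaR p dpi i * G i z)
    (hGK : ∀ i, 1 ≤ i → i ≤ m → ∀ z ∈ kSetPi k f P p B dpi l m, G i z = 0)
    (hKcompact : IsCompact (kSetPi k f P p B dpi l m))
    (hKbd : kSetPi k f P p B dpi l m = {z | ∃ C : ℝ, ∀ n : ℕ, ‖f^[n] z‖ ≤ C})
    (hKinv : MapsTo f (kSetPi k f P p B dpi l m) (kSetPi k f P p B dpi l m))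
    (W : Set (EuclideanSpace ℂ (Fin k)))
    (hWopen : IsOpen W) (hWbd : Bornology.IsBounded W)
    (hWK : kSetPi k f P p B dpi l m ⊆ W)
    (N : ℕ) (hN : 1 ≤ N) (L : ℝ) (hL : 1 < L)
    (hLip : ∀ u ∈ W, ∀ v ∈ W, ‖f^[N] u - f^[N] v‖ ≤ L ^ N * ‖u - v‖) :
    ∀ i, 1 ≤ i → i ≤ m → ∀ a : ℝ, 0 < a →
      a < Real.log (alphaR p dpi i) / Real.log L →
      ∃ c : ℝ, 0 < c ∧ ∀ z ∈ kSetPi k f P p B dpi l (i - 1),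
        G i z ≤ c * infDist z (kSetPi k f P p B dpi l m) ^ a := by
  have hlle : ∀ i j, i ≤ j → j ≤ m → l i ≤ l j := by
    intro i j hij hj
    induction j, hij using Nat.le_induction with
    | base => rfl
    | succ n hn ih => exact (ih (by omega)).trans (hlmono n (by omega)).le
  have hple : ∀ i j, 1 ≤ i → i ≤ j → j ≤ m → p i ≤ p j := by
    intro i j hi hij hj
    induction j, hij using Nat.le_induction with
    | base => rfl
    | succ n hn ih => exact (ih (by omega)).trans (hpmono n (by omega) (by omega))
  have hdlt : ∀ i j, 1 ≤ i → i < j → j ≤ m → dpi j < dpi i := by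
    intro i j hi hij hj
    induction j, (hij : i + 1 ≤ j) using Nat.le_induction with
    | base => exact hdpimono i hi (by omega)
    | succ n hn ih =>
      exact (hdpimono n (by omega) (by omega)).trans (ih (by omega))
  have hBle : ∀ (j : Fin k) i, i ≤ m → (B j ≤ i ↔ (j : ℕ) < l i) := by
    intro j i him
    obtain ⟨h1, h2, h3, h4⟩ := hB j
    refine ⟨fun h => h4.trans_le (hlle _ _ h him), fun h => ?_⟩
    by_contra hlt
    have := hlle i (B j - 1) (by omega) (by omega)
    omega
  have hBeq : ∀ (j : Fin k) i, 1 ≤ i → i ≤ m →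
      (B j = i ↔ l (i - 1) ≤ (j : ℕ) ∧ (j : ℕ) < l i) := by
    intro j i hi him
    have h1 := hBle j i him
    have h2 := hBle j (i - 1) (by omega)
    omega
  have hp : ∀ i, 1 ≤ i → i ≤ m → 1 ≤ p i := fun i hi him => hp1.trans (hple 1 i le_rfl hi him)
  have hBm : ∀ j, 1 ≤ B j ∧ B j ≤ m := fun j => ⟨(hB j).1, (hB j).2.1⟩
  have hanti : ∀ i j, 1 ≤ i → i < j → j ≤ m → alphaR p dpi j < alphaR p dpi i := by
    intro i j hi hij hj
    have hpi : (0 : ℝ) < p i := by exact_mod_cast hp i hi (by omega)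
    have hpij : (p i : ℝ) ≤ p j := by exact_mod_cast hple i j hi hij.le hj
    have hdij : (dpi j : ℝ) < dpi i := by exact_mod_cast hdlt i j hi hij hj
    exact (div_le_div_of_nonneg_left (Nat.cast_nonneg _) hpi hpij).trans_lt
      (div_lt_div_of_pos_right hdij hpi)
  have hα : ∀ i, 1 ≤ i → i ≤ m → 1 < alphaR p dpi i := by
    intro i hi him
    rcases him.eq_or_lt with rfl | h
    · exact halpha
    · exact halpha.trans (hanti i m hi h le_rfl)
  have hpd : ∀ i, 1 ≤ i → i ≤ m → p i < dpi i := by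
    intro i hi him
    have hpi : (0 : ℝ) < p i := by exact_mod_cast hp i hi him
    have h := hα i hi him
    rw [alphaR, one_lt_div hpi] at h
    exact_mod_cast h
  have hdegB : ∀ j, (aeval pi (P j)).totalDegree ≤ dpi (B j) := fun j =>
    (hdpi _ (hBm j).1 (hBm j).2).1 j (hB j).2.2.1 (hB j).2.2.2
  have hblockB : ∀ j, ∀ s ∈ (pi j).support, ∀ t, s t ≠ 0 → B t = B j := fun j s hs t ht =>
    (hBeq t _ (hBm j).1 (hBm j).2).2 (hpiblock j s hs t ht)
  have htopB : ∀ r, ∀ w : Fin k → ℂ, (∀ j, B j = B r →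
      eval w (homogeneousComponent (p (B j)) (pi j)) = 0) → ∀ j, B j = B r → w j = 0 := by
    intro r w h j hj
    have hr := (hBeq j _ (hBm r).1 (hBm r).2).1 hj
    refine hpitop (B r) (hBm r).1 (hBm r).2 w (fun t h1 h2 => ?_) j hr.1 hr.2
    have ht := (hBeq t _ (hBm r).1 (hBm r).2).2 ⟨h1, h2⟩
    simpa only [ht] using h t ht
  have hregB : ∀ i, 1 ≤ i → i ≤ m → ∀ w : Fin k → ℂ,
      (∀ j, B j ≤ i → eval w (homogeneousComponent (dpi (B j)) (aeval pi (P j))) = 0) →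
      (∀ j, i < B j → w j = 0) → w = 0 := by
    intro i hi him w h1 h2
    refine hpireg i hi him w (fun r hr hri j hj1 hj2 => ?_) fun j hj => h2 j ?_
    · have hj := (hBeq j r hr (hri.trans him)).2 ⟨hj1, hj2⟩
      simpa only [hj] using h1 j (by omega)
    · have := hBle j i him
      omega
  intro i hi him a ha haα
  set α := alphaR p dpi i with hαdef
  have hα1 : 1 < α := hα i hi him
  set K := kSetPi k f P p B dpi l m
  have hKne : K.Nonempty := by
    obtain ⟨z, hz⟩ := exists_fixedPoint_of_regular P pi (fun j => dpi (B j))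
      (fun j => (hpideg j).trans_lt (hpd _ (hBm j).1 (hBm j).2)) hdegB
      (fun w h => hregB m hm le_rfl w (fun j _ => h j)
        fun j hj => absurd (hBm j).2 (by omega)) f hf
    refine ⟨z, ?_⟩
    rw [show K = _ from hKbd]
    exact ⟨‖z‖, fun n => by rw [(hz.iterate n).eq]⟩
  obtain ⟨C₁, C₂, hC₁, hC₂, hgreen⟩ := exists_green_le P pi B p dpi m hBm hp
    (fun i hi him => (hp i hi him).trans (hpd i hi him).le) hblockB hpideg htopB hdegB hregB
    hanti f hf i hi him hα1
  obtain ⟨C₃, hC₃, hlog⟩ := exists_log_one_add_norm_le_infDist_rpow hKcompact hKne ha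
  have hT := mapsTo_kSetPi f P p B dpi l (i - 1)
  have hGN : ∀ n : ℕ, ∀ z ∈ kSetPi k f P p B dpi l (i - 1), G i (f^[n] z) = α ^ n * G i z := by
    intro n z hz
    induction n with
    | zero => simp
    | succ n ih =>
      rw [Function.iterate_succ_apply', (hGlim i hi him _ (hT.iterate n hz)).2, ih, pow_succ]
      ring
  have hlogL : 0 < Real.log L := Real.log_pos hL
  have hLa : L ^ a ≤ α := by
    rw [lt_div_iff₀ hlogL] at haα
    rw [Real.rpow_le_iff_le_log (by linarith) (by linarith)]
    exact haα.le
  refine exists_le_infDist_rpow (lam := L ^ N) (g := α ^ N) (C₁ := C₁ + C₂ * C₃)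
    (C₂ := C₂ * a⁻¹) hKcompact hKne hWopen hWK (hKinv.iterate N) (hT.iterate N) (by positivity)
    (fun u hu v hv => by simpa only [dist_eq_norm] using hLip u hu v hv) ha
    (one_lt_pow₀ hα1 (by omega)) ?_ (hGN N) (by positivity) (by positivity) fun z hz => ?_
  · have hL0 : 0 ≤ L := by linarith
    rw [← Real.rpow_natCast, ← Real.rpow_mul hL0, mul_comm, Real.rpow_mul hL0, Real.rpow_natCast]
    exact pow_le_pow_left₀ (by positivity) hLa N
  · have h1 := hgreen z _ (hGlim i hi him z hz).1
    have h2 := mul_le_mul_of_nonneg_left (hlog z) hC₂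
    linarith
end

section
/- Let g(z) := (z_1^6 − z_2^4, z_1^3 − z_2^2 + z_2). Then g is not semi-regular: there is no split polynomial map π(z) = (q_1(z_1), q_2(z_2)), with q_1, q_2 one-variable polynomials satisfying 1 ≤ deg q_1 ≤ deg q_2, such that deg((g∘π)_1) ≥ deg((g∘π)_2) and g∘π is regular. -/
open MvPolynomial

/-- `(Q₁, Q₂)` is a regular polynomial map of `ℂ²`: `deg Q₁ ≥ deg Q₂ ≥ 1`, the top
homogeneous parts have no common zero but `0`, and if `deg Q₁ > deg Q₂` the
coefficient of `z₁^{deg Q₁}` in `Q₁` is nonzero. -/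
def Regular2 (Q1 Q2 : MvPolynomial (Fin 2) ℂ) : Prop :=
  Q2.totalDegree ≤ Q1.totalDegree ∧ 1 ≤ Q2.totalDegree ∧
  {z : Fin 2 → ℂ | eval z (homogeneousComponent Q1.totalDegree Q1) = 0 ∧
    eval z (homogeneousComponent Q2.totalDegree Q2) = 0} = {0} ∧
  (Q2.totalDegree < Q1.totalDegree →
    coeff (Finsupp.single (0 : Fin 2) Q1.totalDegree) Q1 ≠ 0)

theorem homogeneousComponent_polynomial_aeval_X {σ R : Type*} [CommSemiring R] (i : σ) (n : ℕ)
    (f : Polynomial R) :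
    homogeneousComponent n (Polynomial.aeval (X i : MvPolynomial σ R) f) =
      monomial (Finsupp.single i n) (f.coeff n) := by
  induction f using Polynomial.induction_on' with
  | add p q hp hq => simp [hp, hq]
  | monomial k c =>
    rw [Polynomial.aeval_monomial, algebraMap_eq, C_mul_X_pow_eq_monomial,
      homogeneousComponent_of_mem
        (isHomogeneous_monomial c (Finsupp.degree_single i k)),
      Polynomial.coeff_monomial]
    by_cases h : n = k
    · simp [h]
    · simp [h, Ne.symm h]

theorem totalDegree_polynomial_aeval_X_le {σ R : Type*} [CommSemiring R] (i : σ)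
    (f : Polynomial R) :
    (Polynomial.aeval (X i : MvPolynomial σ R) f).totalDegree ≤ f.natDegree := by
  rw [Polynomial.aeval_eq_sum_range]
  refine totalDegree_finsetSum_le fun k hk => ?_
  rw [smul_eq_C_mul, C_mul_X_pow_eq_monomial]
  refine (totalDegree_monomial_le _ _).trans ?_
  simpa [Finsupp.sum_single_index, Nat.lt_succ_iff] using hk

theorem eval_homogeneousComponent_aeval_sub_aeval {R : Type*} [CommRing R]
    (f g : Polynomial R) (n : ℕ) (z : Fin 2 → R) :
    eval z (homogeneousComponent n
      (Polynomial.aeval (X 0 : MvPolynomial (Fin 2) R) f - Polynomial.aeval (X 1) g)) =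
      f.coeff n * z 0 ^ n - g.coeff n * z 1 ^ n := by
  simp [homogeneousComponent_polynomial_aeval_X, eval_monomial]

theorem totalDegree_aeval_sub_aeval {R : Type*} [CommRing R] (f g : Polynomial R)
    (h : max f.natDegree g.natDegree ≠ 0) :
    (Polynomial.aeval (X 0 : MvPolynomial (Fin 2) R) f - Polynomial.aeval (X 1) g).totalDegree =
      max f.natDegree g.natDegree := by
  refine le_antisymm ((totalDegree_sub _ _).trans (max_le_max
    (totalDegree_polynomial_aeval_X_le 0 f) (totalDegree_polynomial_aeval_X_le 1 g))) ?_
  by_contra! hlt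
  have key (z : Fin 2 → R) :=
    eval_homogeneousComponent_aeval_sub_aeval f g (max f.natDegree g.natDegree) z
  rw [homogeneousComponent_eq_zero _ _ hlt] at key
  have hf : f.coeff (max f.natDegree g.natDegree) = 0 := by
    simpa [zero_pow h, eq_comm] using key ![1, 0]
  have hg : g.coeff (max f.natDegree g.natDegree) = 0 := by
    simpa [zero_pow h, eq_comm] using key ![0, 1]
  rcases max_choice f.natDegree g.natDegree with hm | hm
  · rw [hm] at hf h
    exact h (by simp [Polynomial.leadingCoeff_eq_zero.mp hf])
  · rw [hm] at hg h
    exact h (by simp [Polynomial.leadingCoeff_eq_zero.mp hg])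

theorem natDegree_sq_sub_self {R : Type*} [CommRing R] [IsDomain R] (q : Polynomial R)
    (hq : 1 ≤ q.natDegree) : (q ^ 2 - q).natDegree = 2 * q.natDegree := by
  rw [Polynomial.natDegree_sub_eq_left_of_natDegree_lt, Polynomial.natDegree_pow]
  rw [Polynomial.natDegree_pow]
  omega

theorem exists_ne_zero_common_zero {K : Type*} [Field K] [IsAlgClosed K] (p q : Polynomial K)
    (hp : 1 ≤ p.natDegree) (hq : 1 ≤ q.natDegree) {d : ℕ}
    (hd : d = max (3 * p.natDegree) (2 * q.natDegree)) :
    ∃ z : Fin 2 → K, z ≠ 0 ∧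
      (p ^ 6).coeff (2 * d) * z 0 ^ (2 * d) - (q ^ 4).coeff (2 * d) * z 1 ^ (2 * d) = 0 ∧
      (p ^ 3).coeff d * z 0 ^ d - (q ^ 2 - q).coeff d * z 1 ^ d = 0 := by
  have hd0 : d ≠ 0 := by omega
  have hq4 : (q ^ 4).natDegree = 4 * q.natDegree := Polynomial.natDegree_pow q 4
  have hp6 : (p ^ 6).natDegree = 6 * p.natDegree := Polynomial.natDegree_pow p 6
  have hp3 : (p ^ 3).natDegree = 3 * p.natDegree := Polynomial.natDegree_pow p 3
  have hq2 := natDegree_sq_sub_self q hq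
  rcases lt_trichotomy (3 * p.natDegree) (2 * q.natDegree) with h | h | h
  · refine ⟨![1, 0], by simp, ?_⟩
    rw [Polynomial.coeff_eq_zero_of_natDegree_lt (p := p ^ 6) (by omega),
      Polynomial.coeff_eq_zero_of_natDegree_lt (p := p ^ 3) (by omega)]
    simp [hd0]
  · have hdp : d = 3 * p.natDegree := by omega
    have hdq : d = 2 * q.natDegree := by omega
    have c6 : (p ^ 6).coeff (2 * d) = p.leadingCoeff ^ 6 := by
      rw [← Polynomial.leadingCoeff_pow, Polynomial.leadingCoeff, hp6]
      congr 1; omega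
    have c3 : (p ^ 3).coeff d = p.leadingCoeff ^ 3 := by
      rw [← Polynomial.leadingCoeff_pow, Polynomial.leadingCoeff, hp3, hdp]
    have c4 : (q ^ 4).coeff (2 * d) = q.leadingCoeff ^ 4 := by
      rw [← Polynomial.leadingCoeff_pow, Polynomial.leadingCoeff, hq4]
      congr 1; omega
    have c2 : (q ^ 2 - q).coeff d = q.leadingCoeff ^ 2 := by
      rw [Polynomial.coeff_sub, Polynomial.coeff_eq_zero_of_natDegree_lt (p := q) (by omega),
        sub_zero, ← Polynomial.leadingCoeff_pow, Polynomial.leadingCoeff,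
        Polynomial.natDegree_pow, hdq]
    have hp0 : p.leadingCoeff ≠ 0 := by
      rw [Polynomial.leadingCoeff_ne_zero]
      rintro rfl
      simp at hp
    obtain ⟨x, hx⟩ := IsAlgClosed.exists_pow_nat_eq
      (q.leadingCoeff ^ 2 / p.leadingCoeff ^ 3) (Nat.pos_of_ne_zero hd0)
    have hx' : p.leadingCoeff ^ 3 * x ^ d = q.leadingCoeff ^ 2 := by
      rw [hx]
      field_simp
    refine ⟨![x, 1], fun hz => by simpa using congrFun hz 1, ?_, ?_⟩
    · rw [c6, c4]
      simp only [Matrix.cons_val_zero, Matrix.cons_val_one, one_pow, mul_one]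
      linear_combination (p.leadingCoeff ^ 3 * x ^ d + q.leadingCoeff ^ 2) * hx'
    · rw [c3, c2]
      simp [hx']
  · refine ⟨![0, 1], by simp, ?_⟩
    rw [Polynomial.coeff_eq_zero_of_natDegree_lt (p := q ^ 4) (by omega),
      Polynomial.coeff_eq_zero_of_natDegree_lt (p := q ^ 2 - q) (by omega)]
    simp [hd0]

/-- (Exemple 3.2, second map.) `g(z) = (z₁⁶ − z₂⁴, z₁³ − z₂² + z₂)`
is not semi-regular: there is no split polynomial map `π(z) = (q₁(z₁), q₂(z₂))` with
`1 ≤ deg q₁ ≤ deg q₂` such that `deg((g∘π)₁) ≥ deg((g∘π)₂)` and `g∘π` is regular. -/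
theorem stmt17 (P1 P2 : MvPolynomial (Fin 2) ℂ)
    (hP1 : P1 = X 0 ^ 6 - X 1 ^ 4)
    (hP2 : P2 = X 0 ^ 3 - X 1 ^ 2 + X 1) :
    ¬ ∃ q1 q2 : Polynomial ℂ, 1 ≤ q1.natDegree ∧ q1.natDegree ≤ q2.natDegree ∧
      Regular2
        (aeval ![Polynomial.eval₂ (MvPolynomial.C : ℂ →+* MvPolynomial (Fin 2) ℂ)
            (X 0) q1,
          Polynomial.eval₂ (MvPolynomial.C : ℂ →+* MvPolynomial (Fin 2) ℂ) (X 1) q2] P1)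
        (aeval ![Polynomial.eval₂ (MvPolynomial.C : ℂ →+* MvPolynomial (Fin 2) ℂ)
            (X 0) q1,
          Polynomial.eval₂ (MvPolynomial.C : ℂ →+* MvPolynomial (Fin 2) ℂ) (X 1) q2] P2) := by
  rintro ⟨q1, q2, h1, h12, -, -, hzero, -⟩
  have h2 : 1 ≤ q2.natDegree := h1.trans h12
  set d := max (3 * q1.natDegree) (2 * q2.natDegree) with hd
  have e1 : aeval ![Polynomial.eval₂ (C : ℂ →+* MvPolynomial (Fin 2) ℂ) (X 0) q1,
      Polynomial.eval₂ (C : ℂ →+* MvPolynomial (Fin 2) ℂ) (X 1) q2] P1 =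
      Polynomial.aeval (X 0 : MvPolynomial (Fin 2) ℂ) (q1 ^ 6) -
        Polynomial.aeval (X 1) (q2 ^ 4) := by
    simp [hP1, Polynomial.aeval_def, algebraMap_eq, Polynomial.eval₂_pow]
  have e2 : aeval ![Polynomial.eval₂ (C : ℂ →+* MvPolynomial (Fin 2) ℂ) (X 0) q1,
      Polynomial.eval₂ (C : ℂ →+* MvPolynomial (Fin 2) ℂ) (X 1) q2] P2 =
      Polynomial.aeval (X 0 : MvPolynomial (Fin 2) ℂ) (q1 ^ 3) -
        Polynomial.aeval (X 1) (q2 ^ 2 - q2) := by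
    simp [hP2, Polynomial.aeval_def, algebraMap_eq, Polynomial.eval₂_pow]
    ring
  have m1 : max (q1 ^ 6).natDegree (q2 ^ 4).natDegree = 2 * d := by
    rw [Polynomial.natDegree_pow, Polynomial.natDegree_pow]
    omega
  have m2 : max (q1 ^ 3).natDegree (q2 ^ 2 - q2).natDegree = d := by
    rw [Polynomial.natDegree_pow, natDegree_sq_sub_self q2 h2]
  rw [e1, e2, totalDegree_aeval_sub_aeval _ _ (by omega),
    totalDegree_aeval_sub_aeval _ _ (by omega), m1, m2] at hzero
  obtain ⟨z, hz, hz1, hz2⟩ := exists_ne_zero_common_zero q1 q2 h1 h2 hd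
  refine hz (hzero.subset ⟨?_, ?_⟩)
  · rw [eval_homogeneousComponent_aeval_sub_aeval, hz1]
  · rw [eval_homogeneousComponent_aeval_sub_aeval, hz2]
end

section
/- Assume f is (π, 1)-regular, i.e. {z ∈ ℂ^k : (P∘π)^+_{(1)}(z) = 0 and z_{(>1)} = 0} = {0}. Then f is 1-regular, i.e. {z ∈ ℂ^k : P^+_{(1)}(z) = 0 and z_{(>1)} = 0} = {0}. -/
open MvPolynomial

namespace MvPolynomial

theorem height_eq_card_of_isMaximal {K σ : Type*} [Field K] [Finite σ]
    (M : Ideal (MvPolynomial σ K)) [hM : M.IsMaximal] : M.height = Nat.card σ := by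
  revert M
  refine Finite.induction_empty_option
    (P := fun τ ↦ ∀ (M : Ideal (MvPolynomial τ K)) [M.IsMaximal], M.height = Nat.card τ)
    ?_ ?_ ?_ σ
  · intro α β e h M hM
    let r := (renameEquiv K e).toRingEquiv
    have := Ideal.comap_isMaximal_of_equiv r (p := M)
    rw [← r.height_comap M, h, Nat.card_congr e]
  · intro M hM
    let r := (isEmptyRingEquiv K PEmpty).symm
    have := Ideal.comap_isMaximal_of_equiv r (p := M)
    have h0 : M.comap r = ⊥ := Ideal.eq_bot_of_prime _
    rw [← r.height_comap M, h0]
    simp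
  · intro α _ h M hM
    let r := (optionEquivLeft K α).symm.toRingEquiv
    have := Ideal.comap_isMaximal_of_equiv r (p := M)
    set N := M.comap r
    have : (N.under (MvPolynomial α K)).IsMaximal :=
      Polynomial.isMaximal_comap_C_of_isJacobsonRing N
    have : N.LiesOver (N.under (MvPolynomial α K)) := ⟨rfl⟩
    rw [← r.height_comap M, Polynomial.height_eq_height_add_one (N.under _) N, h]
    simp

theorem IsHomogeneous.eval_smul {R σ : Type*} [CommSemiring R] {φ : MvPolynomial σ R} {n : ℕ}
    (hφ : φ.IsHomogeneous n) (c : R) (v : σ → R) : eval (c • v) φ = c ^ n * eval v φ := by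
  rw [eval_eq, eval_eq, Finset.mul_sum]
  refine Finset.sum_congr rfl fun s hs ↦ ?_
  have : ∑ i ∈ s.support, s i = n := (hφ.degree_eq_sum_deg_support hs).symm
  simp only [Pi.smul_apply, smul_eq_mul, mul_pow, Finset.prod_mul_distrib,
    Finset.prod_pow_eq_pow_sum, this]
  ring

/-- Over an algebraically closed field, `n` homogeneous polynomials in `n` variables whose only
common zero is the origin define a surjective map. -/
theorem exists_eval_eq_of_isHomogeneous {K σ : Type*} [Field K] [IsAlgClosed K] [Finite σ]
    {G : σ → MvPolynomial σ K} {q : σ → ℕ} (hq : ∀ i, q i ≠ 0)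
    (hG : ∀ i, (G i).IsHomogeneous (q i))
    (h0 : ∀ w, (∀ i, eval w (G i) = 0) → w = 0) (y : σ → K) :
    ∃ w, ∀ i, eval w (G i) = y i := by
  let H : σ → MvPolynomial (Option σ) K := fun i ↦ rename some (G i) - C (y i) * X none ^ q i
  have hH (v : Option σ → K) (i : σ) :
      eval v (H i) = eval (v ∘ some) (G i) - y i * v none ^ q i := by
    simp [H, eval_rename]
  obtain ⟨v, hv, hv0⟩ : ∃ v : Option σ → K, (∀ i, eval v (H i) = 0) ∧ v ≠ 0 := by
    by_contra! hcon
    have hH0 (i : σ) : eval 0 (H i) = 0 := by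
      have : eval ((0 : K) • (0 : σ → K)) (G i) = 0 := by
        rw [(hG i).eval_smul, zero_pow (hq i), zero_mul]
      rw [zero_smul] at this
      rw [hH, Pi.zero_comp, this, Pi.zero_apply, zero_pow (hq i), mul_zero, sub_zero]
    have hzero : zeroLocus K (Ideal.span (Set.range H)) = {0} := by
      ext v
      simp only [zeroLocus_span, Set.mem_ofPred_eq, Set.forall_mem_range, Set.mem_singleton_iff]
      exact ⟨hcon v, fun h ↦ h ▸ hH0⟩
    have hrad : (Ideal.span (Set.range H)).radical = vanishingIdeal K {(0 : Option σ → K)} := by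
      rw [← vanishingIdeal_zeroLocus_eq_radical (K := K), hzero]
    have hmin : vanishingIdeal K {(0 : Option σ → K)} ∈
        (Ideal.span (Set.range H)).minimalPrimes := by
      rw [← Ideal.radical_minimalPrimes, hrad, Ideal.minimalPrimes_eq_subsingleton_self]
      rfl
    have h1 := Ideal.height_le_card_of_mem_minimalPrimes_span (Set.finite_range H) hmin
    rw [height_eq_card_of_isMaximal, Finite.card_option] at h1
    have h2 : (Set.range H).ncard ≤ Nat.card σ := by
      rw [← Nat.card_coe_set_eq]
      exact Finite.card_range_le H
    have h3 : Nat.card σ + 1 ≤ (Set.range H).ncard := by exact_mod_cast h1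
    omega
  simp only [hH, sub_eq_zero] at hv
  have hne : v none ≠ 0 := by
    intro h
    refine hv0 (_root_.funext fun o ↦ ?_)
    cases o with
    | none => exact h
    | some i =>
      exact congrFun (h0 (v ∘ some) fun i ↦ by rw [hv, h, zero_pow (hq i), mul_zero]) i
  refine ⟨(v none)⁻¹ • (v ∘ some), fun i ↦ ?_⟩
  rw [(hG i).eval_smul, hv, inv_pow]
  field_simp

theorem homogeneousComponent_mul_of_totalDegree_le {R σ : Type*} [CommSemiring R]
    {f g : MvPolynomial σ R} {a b : ℕ} (hf : f.totalDegree ≤ a) (hg : g.totalDegree ≤ b) :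
    homogeneousComponent (a + b) (f * g) = homogeneousComponent a f * homogeneousComponent b g := by
  classical
  have hzero {h : MvPolynomial σ R} {c : ℕ} (hh : h.totalDegree ≤ c) {x : σ →₀ ℕ}
      (hx : c < x.degree) : coeff x h = 0 :=
    coeff_eq_zero_of_totalDegree_lt (hh.trans_lt hx)
  ext s
  simp only [coeff_homogeneousComponent, coeff_mul]
  split_ifs with hs
  · refine Finset.sum_congr rfl fun x hx ↦ ?_
    have hdeg : x.1.degree + x.2.degree = a + b := by
      rw [← map_add, Finset.HasAntidiagonal.mem_antidiagonal.mp hx, hs]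
    rcases lt_trichotomy x.1.degree a with h | h | h
    · rw [hzero hg (by omega : b < x.2.degree)]; simp
    · rw [if_pos h, if_pos (by omega)]
    · rw [hzero hf h]; simp
  · refine (Finset.sum_eq_zero fun x hx ↦ ?_).symm
    have hdeg : x.1.degree + x.2.degree = s.degree := by
      rw [← map_add, Finset.HasAntidiagonal.mem_antidiagonal.mp hx]
    by_cases h : x.1.degree = a
    · rw [if_neg (by omega : ¬ x.2.degree = b), mul_zero]
    · rw [if_neg h, zero_mul]

theorem eval_aeval_eq_eval {R σ τ : Type*} [CommSemiring R] (w : τ → R)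
    (f : σ → MvPolynomial τ R) (Q : MvPolynomial σ R) :
    eval w (aeval f Q) = eval (fun i ↦ eval w (f i)) Q := by
  induction Q using MvPolynomial.induction_on with
  | C a => simp
  | add p q hp hq => rw [map_add (aeval f), map_add, map_add, hp, hq]
  | mul_X p i hp => rw [map_mul (aeval f), map_mul, map_mul, hp, aeval_X, eval_X]

section TopComponent

variable {R σ τ : Type*} [CommSemiring R] {f : σ → MvPolynomial τ R} {q : σ → ℕ}

theorem totalDegree_aeval_monomial_le (hf : ∀ i, (f i).totalDegree ≤ q i) (s : σ →₀ ℕ) :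
    (aeval f (monomial s (1 : R))).totalDegree ≤ Finsupp.weight q s := by
  rw [aeval_monomial, map_one, one_mul, Finsupp.weight_apply]
  refine (totalDegree_finsetProd _ _).trans (Finset.sum_le_sum fun i _ ↦ ?_)
  exact (totalDegree_pow _ _).trans (Nat.mul_le_mul_left _ (hf i))

theorem homogeneousComponent_aeval_monomial (hf : ∀ i, (f i).totalDegree ≤ q i) (s : σ →₀ ℕ) :
    homogeneousComponent (Finsupp.weight q s) (aeval f (monomial s (1 : R))) =
      aeval (fun i ↦ homogeneousComponent (q i) (f i)) (monomial s (1 : R)) := by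
  have hadd (s t : σ →₀ ℕ) : monomial (s + t) (1 : R) = monomial s 1 * monomial t 1 := by
    simp [monomial_mul]
  induction s using Finsupp.induction_linear with
  | zero => simp
  | add s t hs ht =>
    rw [hadd, map_mul (aeval f), map_mul (aeval _), map_add, ← hs, ← ht]
    exact homogeneousComponent_mul_of_totalDegree_le (totalDegree_aeval_monomial_le hf s)
      (totalDegree_aeval_monomial_le hf t)
  | single i n =>
    induction n with
    | zero => simp
    | succ n ih =>
      rw [Finsupp.single_add, hadd, map_mul (aeval f), map_mul (aeval _), map_add, ← ih,
        homogeneousComponent_mul_of_totalDegree_le (totalDegree_aeval_monomial_le hf _)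
        (totalDegree_aeval_monomial_le hf _)]
      rw [Finsupp.weight_single q i 1, one_smul, ← X, aeval_X, aeval_X]

/-- The degree `D` part of a composition `Q ∘ f` is obtained by composing the part of weight `D`
of `Q` with the top homogeneous parts of `f`. -/
theorem homogeneousComponent_aeval (hf : ∀ i, (f i).totalDegree ≤ q i) {Q : MvPolynomial σ R}
    {D : ℕ} (hQ : weightedTotalDegree q Q ≤ D) :
    homogeneousComponent D (aeval f Q) =
      aeval (fun i ↦ homogeneousComponent (q i) (f i)) (weightedHomogeneousComponent q D Q) := by
  classical
  have hmon (s : σ →₀ ℕ) (c : R) : monomial s c = C c * monomial s 1 := by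
    rw [C_mul_monomial, mul_one]
  rw [weightedHomogeneousComponent_apply, Finset.sum_filter, map_sum]
  conv_lhs => rw [Q.as_sum, map_sum, map_sum]
  refine Finset.sum_congr rfl fun s hs ↦ ?_
  rw [hmon, map_mul, aeval_C, algebraMap_eq, homogeneousComponent_C_mul]
  split_ifs with h
  · rw [map_mul, aeval_C, algebraMap_eq, ← h, homogeneousComponent_aeval_monomial hf]
  · have hlt : Finsupp.weight q s < D :=
      lt_of_le_of_ne ((le_weightedTotalDegree q hs).trans hQ) h
    rw [homogeneousComponent_eq_zero _ _ ((totalDegree_aeval_monomial_le hf s).trans_lt hlt),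
      mul_zero, map_zero]

end TopComponent

theorem weightedHomogeneousComponent_weightedTotalDegree_ne_zero {R σ : Type*} [CommSemiring R]
    (q : σ → ℕ) {Q : MvPolynomial σ R} (hQ : Q ≠ 0) :
    weightedHomogeneousComponent q (weightedTotalDegree q Q) Q ≠ 0 := by
  classical
  obtain ⟨s, hs, hsw⟩ := Finset.exists_mem_eq_sup Q.support (support_nonempty.mpr hQ)
    fun s ↦ Finsupp.weight q s
  refine ne_zero_iff.mpr ⟨s, ?_⟩
  rw [coeff_weightedHomogeneousComponent, weightedTotalDegree, if_pos hsw.symm]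
  exact mem_support_iff.mp hs

theorem weightedTotalDegree_le_totalDegree_aeval {K σ : Type*} [Field K] [IsAlgClosed K] [Finite σ]
    {f : σ → MvPolynomial σ K} {q : σ → ℕ} (hq : ∀ i, q i ≠ 0)
    (hf : ∀ i, (f i).totalDegree ≤ q i)
    (h0 : ∀ w, (∀ i, eval w (homogeneousComponent (q i) (f i)) = 0) → w = 0)
    (Q : MvPolynomial σ K) : weightedTotalDegree q Q ≤ (aeval f Q).totalDegree := by
  rcases eq_or_ne Q 0 with rfl | hQ
  · simp [weightedTotalDegree_zero]
  by_contra! hlt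
  refine weightedHomogeneousComponent_weightedTotalDegree_ne_zero q hQ (funext fun y ↦ ?_)
  obtain ⟨w, hw⟩ := exists_eval_eq_of_isHomogeneous hq
    (fun i ↦ homogeneousComponent_isHomogeneous (q i) (f i)) h0 y
  have := congrArg (eval w) (homogeneousComponent_aeval hf (Q := Q) le_rfl)
  rw [homogeneousComponent_eq_zero _ _ hlt, map_zero, eval_aeval_eq_eval] at this
  simpa only [hw, map_zero] using this.symm

end MvPolynomial

/-- A `(π,1)`-regular map is `1`-regular (hence algebraically
stable): if the top homogeneous parts of the first block of `f∘π` have no common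
zero on `{z_{(>1)} = 0}` other than `0`, then the same holds for the top homogeneous
parts of the first block of `f`. -/
theorem stmt18 (k m : ℕ) (hk : 0 < k) (hm : 1 ≤ m)
    (l : ℕ → ℕ) (hl0 : l 0 = 0) (hlm : l m = k)
    (hlmono : ∀ i < m, l i < l (i + 1))
    (P : Fin k → MvPolynomial (Fin k) ℂ)
    (d : ℕ → ℕ)
    (hdeg : ∀ i, 1 ≤ i → i ≤ m → ∀ j : Fin k,
      l (i - 1) ≤ (j : ℕ) → (j : ℕ) < l i → (P j).totalDegree = d i)
    (hdmono : ∀ i, 1 ≤ i → i < m → d (i + 1) < d i)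
    (hdm : 1 ≤ d m)
    (p : ℕ → ℕ) (hp1 : 1 ≤ p 1)
    (hpmono : ∀ i, 1 ≤ i → i < m → p i ≤ p (i + 1))
    (B : Fin k → ℕ)
    (hB : ∀ j : Fin k, 1 ≤ B j ∧ B j ≤ m ∧ l (B j - 1) ≤ (j : ℕ) ∧ (j : ℕ) < l (B j))
    (pi : Fin k → MvPolynomial (Fin k) ℂ)
    (hpiblock : ∀ j : Fin k, ∀ s ∈ (pi j).support, ∀ t : Fin k,
      s t ≠ 0 → l (B j - 1) ≤ (t : ℕ) ∧ (t : ℕ) < l (B j))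
    (hpideg : ∀ j : Fin k, (pi j).totalDegree ≤ p (B j))
    (hpitop : ∀ i, 1 ≤ i → i ≤ m → ∀ w : Fin k → ℂ,
      (∀ j : Fin k, l (i - 1) ≤ (j : ℕ) → (j : ℕ) < l i →
        eval w (homogeneousComponent (p i) (pi j)) = 0) →
      ∀ j : Fin k, l (i - 1) ≤ (j : ℕ) → (j : ℕ) < l i → w j = 0)
    (dpi1 : ℕ)
    (hdpi1a : ∀ j : Fin k, (j : ℕ) < l 1 → (aeval pi (P j)).totalDegree ≤ dpi1)
    (hdpi1b : ∃ j : Fin k, (j : ℕ) < l 1 ∧ (aeval pi (P j)).totalDegree = dpi1)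
    (hpireg : ∀ z : Fin k → ℂ,
      (∀ j : Fin k, (j : ℕ) < l 1 →
        eval z (homogeneousComponent dpi1 (aeval pi (P j))) = 0) →
      (∀ j : Fin k, l 1 ≤ (j : ℕ) → z j = 0) → z = 0) :
    ∀ z : Fin k → ℂ,
      (∀ j : Fin k, (j : ℕ) < l 1 →
        eval z (homogeneousComponent (d 1) (P j)) = 0) →
      (∀ j : Fin k, l 1 ≤ (j : ℕ) → z j = 0) → z = 0 := by
  have hlmono' (a b : ℕ) (hab : a ≤ b) (hbm : b ≤ m) : l a ≤ l b := by
    induction b, hab using Nat.le_induction with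
    | base => rfl
    | succ n _ ih => exact (ih (by omega)).trans (hlmono n (by omega)).le
  have hBuniq (i : ℕ) (hi : 1 ≤ i) (him : i ≤ m) (j : Fin k) (h1 : l (i - 1) ≤ (j : ℕ))
      (h2 : (j : ℕ) < l i) : B j = i := by
    obtain ⟨b1, b2, b3, b4⟩ := hB j
    rcases lt_trichotomy (B j) i with h | h | h
    · have := hlmono' (B j) (i - 1) (by omega) (by omega)
      omega
    · exact h
    · have := hlmono' i (B j - 1) (by omega) (by omega)
      omega
  have hB1 (j : Fin k) (hj : (j : ℕ) < l 1) : B j = 1 := hBuniq 1 le_rfl hm j (by simp [hl0]) hj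
  have hple (i : ℕ) (hi : 1 ≤ i) (him : i ≤ m) : p 1 ≤ p i := by
    induction i, hi using Nat.le_induction with
    | base => rfl
    | succ n hn ih => exact (ih (by omega)).trans (hpmono n hn (by omega))
  set q : Fin k → ℕ := fun j ↦ p (B j) with hq_def
  have hpq (j : Fin k) : p 1 ≤ q j := hple _ (hB j).1 (hB j).2.1
  have hq (j : Fin k) : q j ≠ 0 := by have := hpq j; omega
  have hpi0 (w : Fin k → ℂ) (hw : ∀ j, eval w (homogeneousComponent (q j) (pi j)) = 0) : w = 0 := by
    ext j
    obtain ⟨b1, b2, b3, b4⟩ := hB j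
    refine hpitop (B j) b1 b2 w (fun i h1 h2 ↦ ?_) j b3 b4
    rw [← hBuniq (B j) b1 b2 i h1 h2]
    exact hw i
  have hweight (s : Fin k →₀ ℕ) : p 1 * s.degree ≤ Finsupp.weight q s := by
    rw [Finsupp.weight_apply, Finsupp.degree_apply, Finset.mul_sum]
    refine Finset.sum_le_sum fun i _ ↦ ?_
    dsimp only
    rw [smul_eq_mul, mul_comm]
    exact Nat.mul_le_mul_left _ (hpq i)
  have hdeg1 (j : Fin k) (hj : (j : ℕ) < l 1) : (P j).totalDegree = d 1 :=
    hdeg 1 le_rfl hm j (by simp [hl0]) hj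
  have hwdeg (j : Fin k) (hj : (j : ℕ) < l 1) : weightedTotalDegree q (P j) ≤ dpi1 :=
    (weightedTotalDegree_le_totalDegree_aeval hq hpideg hpi0 (P j)).trans (hdpi1a j hj)
  have hlower : p 1 * d 1 ≤ dpi1 := by
    rcases Nat.eq_zero_or_pos (d 1) with hd | hd
    · simp [hd]
    obtain ⟨j, hj, -⟩ := hdpi1b
    have hP : (P j).support.Nonempty := by
      rw [support_nonempty]
      intro h
      have := hdeg1 j hj
      rw [h, totalDegree_zero] at this
      omega
    obtain ⟨s, hs, hsd⟩ := Finset.exists_mem_eq_sup (P j).support hP fun s ↦ s.degree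
    have hsd' : s.degree = d 1 := by
      rw [← hdeg1 j hj, ← hsd]
      rfl
    rw [← hsd']
    exact (hweight s).trans ((le_weightedTotalDegree q hs).trans (hwdeg j hj))
  intro z hz hz1
  obtain ⟨w, hw⟩ := exists_eval_eq_of_isHomogeneous hq
    (fun i ↦ homogeneousComponent_isHomogeneous (q i) (pi i)) hpi0 z
  have hw0 : w = 0 := by
    refine hpireg w (fun j hj ↦ ?_) fun j hj ↦ ?_
    · rw [homogeneousComponent_aeval hpideg (hwdeg j hj), eval_aeval_eq_eval,
        show (fun i ↦ eval w (homogeneousComponent (q i) (pi i))) = z from _root_.funext hw]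
      have hterm (s : Fin k →₀ ℕ) (hs : s ∈ (P j).support) :
          (if Finsupp.weight q s = dpi1 then eval z (monomial s (coeff s (P j))) else 0) =
            if dpi1 = p 1 * d 1 then
              if s.degree = d 1 then eval z (monomial s (coeff s (P j))) else 0 else 0 := by
        by_cases hsupp : ∃ t, s t ≠ 0 ∧ l 1 ≤ (t : ℕ)
        · obtain ⟨t, hst, ht⟩ := hsupp
          have : eval z (monomial s (coeff s (P j))) = 0 := by
            rw [eval_monomial, Finsupp.prod, Finset.prod_eq_zero (Finsupp.mem_support_iff.mpr hst),
              mul_zero]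
            rw [hz1 t ht, zero_pow hst]
          simp [this]
        · push Not at hsupp
          have hw1 : Finsupp.weight q s = p 1 * s.degree := by
            rw [Finsupp.weight_apply, Finsupp.degree_apply, Finset.mul_sum]
            refine Finset.sum_congr rfl fun i hi ↦ ?_
            have hBi : q i = p 1 := by
              rw [hq_def]
              exact congrArg p (hB1 i (hsupp i (Finsupp.mem_support_iff.mp hi)))
            dsimp only
            rw [hBi, smul_eq_mul, mul_comm]
          have hsd : s.degree ≤ d 1 := by
            rw [← hdeg1 j hj]
            exact le_totalDegree hs
          have hmul : p 1 * s.degree ≤ p 1 * d 1 := Nat.mul_le_mul_left _ hsd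
          by_cases h : s.degree = d 1
          · simp only [hw1, h, if_true, eq_comm]
          · have : p 1 * s.degree ≠ dpi1 := by
              intro h'
              exact h (Nat.eq_of_mul_eq_mul_left hp1 (by omega))
            simp [hw1, h, this]
      have hzj := hz j hj
      rw [homogeneousComponent_apply, map_sum, Finset.sum_filter] at hzj
      rw [weightedHomogeneousComponent_apply, map_sum, Finset.sum_filter,
        Finset.sum_congr rfl hterm]
      split_ifs
      · exact hzj
      · exact Finset.sum_const_zero
    · obtain ⟨b1, b2, b3, b4⟩ := hB j
      refine hpitop (B j) b1 b2 w (fun i h1 h2 ↦ ?_) j b3 b4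
      have hBi := hBuniq (B j) b1 b2 i h1 h2
      rw [← hBi]
      refine (hw i).trans (hz1 i ?_)
      by_contra! hlt
      have h3 : B j = 1 := hBi ▸ hB1 i hlt
      rw [h3] at b4
      omega
  ext i
  rw [← hw i, hw0, Pi.zero_apply, ← zero_smul ℂ (0 : Fin k → ℂ),
    (homogeneousComponent_isHomogeneous (q i) (pi i)).eval_smul, zero_pow (hq i), zero_mul]
end

section
/- Assume f is 1-regular, i.e. {z ∈ ℂ^k : P^+_{(1)}(z) = 0 and z_{(>1)} = 0} = {0}. Then for every n ≥ 1 the algebraic degree of f^n equals d_1^n; more precisely, the first block (f^n)_{(1)} of coordinates of the n-th iterate has degree exactly d_1^n, while every other coordinate of f^n has degree strictly less than d_1^n. -/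
open MvPolynomial

namespace MvPolynomial

variable {σ τ R : Type*} [CommSemiring R]

theorem homogeneousComponent_mul_of_totalDegree_le_s19 {p q : MvPolynomial σ R} {a b : ℕ}
    (hp : p.totalDegree ≤ a) (hq : q.totalDegree ≤ b) :
    homogeneousComponent (a + b) (p * q) =
      homogeneousComponent a p * homogeneousComponent b q := by
  classical
  ext s
  rw [coeff_homogeneousComponent, coeff_mul, coeff_mul,
    ← Finset.sum_const_zero (s := Finset.HasAntidiagonal.antidiagonal s), ← Finset.sum_ite_irrel]
  refine Finset.sum_congr rfl fun x hx => ?_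
  rw [coeff_homogeneousComponent, coeff_homogeneousComponent]
  have hs : s.degree = x.1.degree + x.2.degree := by
    rw [← Finset.HasAntidiagonal.mem_antidiagonal.mp hx, map_add]
  have h1 : a < x.1.degree → coeff x.1 p = 0 := fun h =>
    coeff_eq_zero_of_totalDegree_lt (hp.trans_lt h)
  have h2 : b < x.2.degree → coeff x.2 q = 0 := fun h =>
    coeff_eq_zero_of_totalDegree_lt (hq.trans_lt h)
  grind

theorem homogeneousComponent_pow_of_totalDegree_le {p : MvPolynomial σ R} {a : ℕ}
    (hp : p.totalDegree ≤ a) (n : ℕ) :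
    homogeneousComponent (n * a) (p ^ n) = homogeneousComponent a p ^ n := by
  induction n with
  | zero => simp
  | succ n ih =>
    have hn : (p ^ n).totalDegree ≤ n * a :=
      (totalDegree_pow p n).trans (Nat.mul_le_mul_left n hp)
    rw [add_mul, one_mul, pow_succ, pow_succ,
      homogeneousComponent_mul_of_totalDegree_le_s19 hn hp, ih]

theorem totalDegree_prod_pow_le {ι : Type*} (s : Finset ι) {g : ι → MvPolynomial σ R} {a : ℕ}
    (hg : ∀ i, (g i).totalDegree ≤ a) (e : ι → ℕ) :
    (∏ i ∈ s, g i ^ e i).totalDegree ≤ (∑ i ∈ s, e i) * a := by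
  rw [Finset.sum_mul]
  refine (totalDegree_finsetProd s _).trans (Finset.sum_le_sum fun i _ => ?_)
  exact (totalDegree_pow _ _).trans (Nat.mul_le_mul_left _ (hg i))

theorem homogeneousComponent_prod_pow {ι : Type*} (s : Finset ι) {g : ι → MvPolynomial σ R}
    {a : ℕ} (hg : ∀ i, (g i).totalDegree ≤ a) (e : ι → ℕ) :
    homogeneousComponent ((∑ i ∈ s, e i) * a) (∏ i ∈ s, g i ^ e i) =
      ∏ i ∈ s, homogeneousComponent a (g i) ^ e i := by
  classical
  induction s using Finset.induction_on with
  | empty => simp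
  | insert i s hi ih =>
    have hpow : (g i ^ e i).totalDegree ≤ e i * a :=
      (totalDegree_pow _ _).trans (Nat.mul_le_mul_left _ (hg i))
    rw [Finset.sum_insert hi, Finset.prod_insert hi, Finset.prod_insert hi, add_mul,
      homogeneousComponent_mul_of_totalDegree_le_s19 hpow (totalDegree_prod_pow_le s hg e), ih,
      homogeneousComponent_pow_of_totalDegree_le (hg i)]

theorem totalDegree_aeval_le {g : τ → MvPolynomial σ R} {a : ℕ}
    (hg : ∀ i, (g i).totalDegree ≤ a) (p : MvPolynomial τ R) :
    (aeval g p).totalDegree ≤ p.totalDegree * a := by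
  rw [aeval_def, eval₂_eq]
  refine totalDegree_finsetSum_le fun s hs => ?_
  refine (totalDegree_mul _ _).trans ?_
  rw [algebraMap_eq, totalDegree_C, zero_add]
  exact (totalDegree_prod_pow_le _ hg _).trans (Nat.mul_le_mul_right _ (le_totalDegree hs))

/-- The leading part of a composition is the composition of the leading parts. -/
theorem homogeneousComponent_aeval_s19 {g : τ → MvPolynomial σ R} {a e : ℕ} (ha : 0 < a)
    (hg : ∀ i, (g i).totalDegree ≤ a) {p : MvPolynomial τ R} (hp : p.totalDegree ≤ e) :
    homogeneousComponent (e * a) (aeval g p) =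
      aeval (fun i => homogeneousComponent a (g i)) (homogeneousComponent e p) := by
  rw [aeval_def, eval₂_eq, map_sum, homogeneousComponent_apply, map_sum, Finset.sum_filter]
  refine Finset.sum_congr rfl fun s hs => ?_
  rw [algebraMap_eq, homogeneousComponent_C_mul]
  split_ifs with h
  · subst h
    rw [aeval_monomial, algebraMap_eq, Finsupp.degree_apply,
      homogeneousComponent_prod_pow _ hg, Finsupp.prod]
  · have hlt : s.degree < e := lt_of_le_of_ne ((le_totalDegree hs).trans hp) h
    rw [homogeneousComponent_eq_zero, mul_zero]
    exact (totalDegree_prod_pow_le _ hg _).trans_lt (Nat.mul_lt_mul_of_pos_right hlt ha)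

theorem homogeneousComponent_totalDegree_ne_zero {p : MvPolynomial σ R}
    (hp : 0 < p.totalDegree) : homogeneousComponent p.totalDegree p ≠ 0 := by
  intro h
  obtain ⟨s, hs, hsd⟩ := Finset.exists_mem_eq_sup p.support
    (support_nonempty.mpr fun h0 => by simp [h0] at hp) fun s => s.sum fun _ e => e
  have := congrArg (coeff s) h
  rw [coeff_homogeneousComponent, if_pos (id hsd.symm : s.degree = p.totalDegree),
    coeff_zero] at this
  exact mem_support_iff.mp hs this

end MvPolynomial

/-- A `1`-regular map is algebraically stable: for every `n ≥ 1`
the algebraic degree of `f^n` is `d₁^n`; more precisely the first block of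
coordinates of `f^n` has degree exactly `d₁^n` while every other coordinate has
degree strictly less than `d₁^n`. -/
theorem stmt19 (k m : ℕ) (hk : 0 < k) (hm : 1 ≤ m)
    (l : ℕ → ℕ) (hl0 : l 0 = 0) (hlm : l m = k)
    (hlmono : ∀ i < m, l i < l (i + 1))
    (P : Fin k → MvPolynomial (Fin k) ℂ)
    (d : ℕ → ℕ)
    (hdeg : ∀ i, 1 ≤ i → i ≤ m → ∀ j : Fin k,
      l (i - 1) ≤ (j : ℕ) → (j : ℕ) < l i → (P j).totalDegree = d i)
    (hdmono : ∀ i, 1 ≤ i → i < m → d (i + 1) < d i)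
    (hdm : 1 ≤ d m)
    (hreg : ∀ z : Fin k → ℂ,
      (∀ j : Fin k, (j : ℕ) < l 1 →
        eval z (homogeneousComponent (d 1) (P j)) = 0) →
      (∀ j : Fin k, l 1 ≤ (j : ℕ) → z j = 0) → z = 0)
    (fIter : ℕ → Fin k → MvPolynomial (Fin k) ℂ)
    (hIter0 : ∀ j : Fin k, fIter 0 j = X j)
    (hIterS : ∀ (n : ℕ) (j : Fin k), fIter (n + 1) j = aeval (fIter n) (P j)) :
    ∀ n : ℕ, 1 ≤ n →
      (Finset.univ.sup (fun j : Fin k => (fIter n j).totalDegree) = d 1 ^ n) ∧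
      (∀ j : Fin k, (j : ℕ) < l 1 → (fIter n j).totalDegree ≤ d 1 ^ n) ∧
      (∃ j : Fin k, (j : ℕ) < l 1 ∧ (fIter n j).totalDegree = d 1 ^ n) ∧
      (∀ j : Fin k, l 1 ≤ (j : ℕ) → (fIter n j).totalDegree < d 1 ^ n) := by
  have hanti : ∀ i, 1 ≤ i → i < m → d (i + 1) < d 1 := by
    intro i hi
    induction i, hi using Nat.le_induction with
    | base => exact hdmono 1 le_rfl
    | succ i hi ih => exact fun h => (hdmono (i + 1) (by lia) h).trans (ih (by lia))
  have hd1 : 1 ≤ d 1 := by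
    obtain rfl | hm1 := hm.eq_or_lt
    · exact hdm
    · have := hanti (m - 1) (by lia) (by lia)
      lia
  have hl1 : 0 < l 1 := hl0 ▸ hlmono 0 hm
  have hfirst : ∀ j : Fin k, (j : ℕ) < l 1 → (P j).totalDegree = d 1 := fun j hj =>
    hdeg 1 le_rfl hm j (by simp [hl0]) hj
  have hrest : ∀ j : Fin k, l 1 ≤ (j : ℕ) → (P j).totalDegree < d 1 := by
    intro j hj
    have hblock : ∀ i, i ≤ m → (j : ℕ) < l i →
        ∃ i', 1 ≤ i' ∧ i' < m ∧ l i' ≤ (j : ℕ) ∧ (j : ℕ) < l (i' + 1) := by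
      intro i
      induction i with
      | zero => intro _ h; lia
      | succ i ih =>
        intro him h
        by_cases hi : (j : ℕ) < l i
        · exact ih (by lia) hi
        · refine ⟨i, ?_, by lia, by lia, h⟩
          by_contra h0
          obtain rfl : i = 0 := by lia
          simp only [zero_add] at h
          lia
    obtain ⟨i, hi1, him, hlo, hhi⟩ := hblock m le_rfl (hlm ▸ j.isLt)
    rw [hdeg (i + 1) (by lia) him j (by simpa using hlo) hhi]
    exact hanti i hi1 him
  have hle : ∀ j, (P j).totalDegree ≤ d 1 := fun j =>
    (lt_or_ge (j : ℕ) (l 1)).elim (fun h => (hfirst j h).le) fun h => (hrest j h).le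
  have key : ∀ n : ℕ, 1 ≤ n →
      (∀ j : Fin k, (fIter n j).totalDegree ≤ d 1 ^ n) ∧
      (∃ j : Fin k, (j : ℕ) < l 1 ∧ (fIter n j).totalDegree = d 1 ^ n) ∧
      (∀ j : Fin k, l 1 ≤ (j : ℕ) → (fIter n j).totalDegree < d 1 ^ n) := by
    intro n hn
    induction n, hn using Nat.le_induction with
    | base =>
      have h1 : fIter 1 = P := by
        funext j
        rw [hIterS 0 j, funext hIter0, aeval_X_left_apply]
      rw [h1, pow_one]
      exact ⟨hle, ⟨⟨0, hk⟩, hl1, hfirst _ hl1⟩, hrest⟩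
    | succ n hn ih =>
      obtain ⟨ihle, ⟨j₀, hj₀, hj₀deg⟩, ihrest⟩ := ih
      have hpos : 0 < d 1 ^ n := pow_pos hd1 n
      have hdle : ∀ j, (fIter (n + 1) j).totalDegree ≤ (P j).totalDegree * d 1 ^ n := fun j =>
        hIterS n j ▸ totalDegree_aeval_le ihle (P j)
      have hle' : ∀ j, (fIter (n + 1) j).totalDegree ≤ d 1 ^ (n + 1) := fun j => by
        rw [pow_succ']
        exact (hdle j).trans (Nat.mul_le_mul_right _ (hle j))
      refine ⟨hle', ?_, fun j hj => ?_⟩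
      · by_contra! hne
        have hvanish : ∀ j : Fin k, (j : ℕ) < l 1 →
            aeval (fun i => homogeneousComponent (d 1 ^ n) (fIter n i))
              (homogeneousComponent (d 1) (P j)) = 0 := fun j hj => by
          rw [← homogeneousComponent_aeval_s19 hpos ihle (hle j), ← hIterS, ← pow_succ']
          exact homogeneousComponent_eq_zero _ _ (lt_of_le_of_ne (hle' j) (hne j hj))
        have hzero : homogeneousComponent (d 1 ^ n) (fIter n j₀) = 0 := by
          refine funext fun w => ?_
          rw [map_zero]
          refine congrFun (hreg (fun i => eval w (homogeneousComponent (d 1 ^ n) (fIter n i)))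
            (fun j hj => ?_) fun j hj => ?_) j₀
          · have := congrArg (eval w) (hvanish j hj)
            rwa [map_zero, ← coe_aeval_eq_eval, RingHom.coe_coe, comp_aeval_apply] at this
          · simp only [homogeneousComponent_eq_zero _ _ (ihrest j hj), map_zero]
        exact homogeneousComponent_totalDegree_ne_zero (hj₀deg ▸ hpos) (hj₀deg ▸ hzero)
      · rw [pow_succ']
        exact (hdle j).trans_lt (Nat.mul_lt_mul_of_pos_right (hrest j hj) hpos)
  intro n hn
  obtain ⟨h1, ⟨j, hj, hjd⟩, h3⟩ := key n hn
  refine ⟨le_antisymm (Finset.sup_le fun i _ => h1 i) ?_, fun i _ => h1 i, ⟨j, hj, hjd⟩, h3⟩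
  exact hjd ▸ Finset.le_sup (f := fun i => (fIter n i).totalDegree) (Finset.mem_univ j)
end
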